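/- arXiv:1812.09808 — 8 statements merged into one kernel-verified Lean document; each statement's English description precedes it below -/
import Mathlib

section
/- Let W be a closed subset of ℝ^l equipped with a continuous metric d, let p ∈ [1,∞), let ŵ^(1),…,ŵ^(N) ∈ W, let ν_N := (1/N) Σ_{i=1}^N δ_{ŵ^(i)} be the empirical distribution, and let θ > 0. Then for every Borel probability measure μ on W, W_p(μ, ν_N) ≤ θ holds if and only if for every Borel-measurable function φ : W → ℝ with ∫_W |φ| dμ < ∞ one has ∫_W φ(w) μ(dw) + (1/N) Σ_{i=1}^N inf_{w ∈ W} [ d(w, ŵ^(i))^p − φ(w) ] ≤ θ^p (the inequality understood in the extended reals, with inf possibly equal to −∞). -/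
open MeasureTheory ENNReal

/-- The order-`p` Wasserstein distance (as an extended nonnegative real) between two Borel
probability measures, defined as the infimum over couplings of the `p`-th root of the
transport cost. -/
noncomputable def Wdist {α : Type*} [MeasurableSpace α] (d : α → α → ℝ) (p : ℝ)
    (μ ν : Measure α) : ℝ≥0∞ :=
  ⨅ κ ∈ {κ : Measure (α × α) | IsProbabilityMeasure κ ∧
      κ.map Prod.fst = μ ∧ κ.map Prod.snd = ν},
    (∫⁻ q, ENNReal.ofReal (d q.1 q.2 ^ p) ∂κ) ^ (1 / p)

section LogSumExp

variable {ι : Type*} [Fintype ι]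

/-- The log-sum-exp function on a finite index type. -/
noncomputable def logSumExp (x : ι → ℝ) : ℝ := Real.log (∑ i, Real.exp (x i))

theorem sum_exp_pos [Nonempty ι] (x : ι → ℝ) : 0 < ∑ i, Real.exp (x i) :=
  Finset.sum_pos (fun _ _ => Real.exp_pos _) Finset.univ_nonempty

theorem exp_le_sum_exp (x : ι → ℝ) (j : ι) : Real.exp (x j) ≤ ∑ i, Real.exp (x i) :=
  Finset.single_le_sum (f := fun i => Real.exp (x i)) (fun _ _ => (Real.exp_pos _).le)
    (Finset.mem_univ j)

theorem le_logSumExp [Nonempty ι] (x : ι → ℝ) (j : ι) : x j ≤ logSumExp x :=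
  (Real.le_log_iff_exp_le (sum_exp_pos x)).2 (exp_le_sum_exp x j)

theorem logSumExp_le_add [Nonempty ι] {x y : ι → ℝ} {r : ℝ} (h : ∀ i, x i ≤ y i + r) :
    logSumExp x ≤ logSumExp y + r := by
  unfold logSumExp
  rw [Real.log_le_iff_le_exp (sum_exp_pos x), Real.exp_add, Real.exp_log (sum_exp_pos y),
    Finset.sum_mul]
  refine Finset.sum_le_sum fun i _ => ?_
  rw [← Real.exp_add]
  exact Real.exp_le_exp.2 (h i)

theorem lipschitzWith_logSumExp [Nonempty ι] : LipschitzWith 1 (logSumExp (ι := ι)) := by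
  refine LipschitzWith.of_le_add fun x y => logSumExp_le_add fun i => ?_
  have := (le_abs_self _).trans ((Real.norm_eq_abs _).symm.le.trans (norm_le_pi_norm (x - y) i))
  rw [← dist_eq_norm] at this
  simp only [Pi.sub_apply] at this
  linarith

/-- The Gibbs (softmax) weights, the partial derivatives of `logSumExp`. -/
noncomputable def softmax (x : ι → ℝ) (i : ι) : ℝ := Real.exp (x i) / ∑ k, Real.exp (x k)

theorem softmax_nonneg (x : ι → ℝ) (i : ι) : 0 ≤ softmax x i := by
  unfold softmax; positivity

theorem softmax_pos [Nonempty ι] (x : ι → ℝ) (i : ι) : 0 < softmax x i :=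
  div_pos (Real.exp_pos _) (sum_exp_pos x)

theorem softmax_le_one [Nonempty ι] (x : ι → ℝ) (i : ι) : softmax x i ≤ 1 :=
  (div_le_one (sum_exp_pos x)).2 (exp_le_sum_exp x i)

theorem sum_softmax [Nonempty ι] (x : ι → ℝ) : ∑ i, softmax x i = 1 := by
  simp only [softmax]
  rw [← Finset.sum_div, div_self (sum_exp_pos x).ne']

theorem continuous_softmax [Nonempty ι] (i : ι) : Continuous fun x : ι → ℝ => softmax x i := by
  unfold softmax
  exact Continuous.div (by fun_prop) (by fun_prop) fun x => (sum_exp_pos x).ne'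

/-- Crude form of the Gibbs variational principle: the entropy of the weights is at most
`card ι`. -/
theorem le_sum_softmax_mul_add_card [Nonempty ι] (x : ι → ℝ) (j : ι) :
    x j ≤ ∑ i, softmax x i * x i + Fintype.card ι := by
  refine (le_logSumExp x j).trans ?_
  have h : ∀ i, softmax x i * (logSumExp x - x i) ≤ 1 := fun i => by
    have h1 : Real.log (softmax x i) = x i - logSumExp x := by
      rw [softmax, Real.log_div (Real.exp_pos _).ne' (sum_exp_pos x).ne', Real.log_exp, logSumExp]
    have h2 := Real.one_sub_inv_le_log_of_pos (softmax_pos x i)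
    have h3 := mul_le_mul_of_nonneg_left h2 (softmax_nonneg x i)
    rw [mul_sub, mul_inv_cancel₀ (softmax_pos x i).ne', h1] at h3
    linarith [softmax_nonneg x i]
  have h' := Finset.sum_le_sum fun i (_ : i ∈ Finset.univ) => h i
  simp only [mul_sub, Finset.sum_sub_distrib, ← Finset.sum_mul, sum_softmax, one_mul,
    Finset.sum_const, Finset.card_univ, nsmul_eq_mul, mul_one] at h'
  linarith

theorem hasDerivAt_logSumExp_single [Nonempty ι] [DecidableEq ι] (x : ι → ℝ) (i : ι) (t : ℝ) :
    HasDerivAt (fun t : ℝ => logSumExp (x + Pi.single i t)) (softmax (x + Pi.single i t) i) t := by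
  unfold logSumExp softmax
  refine HasDerivAt.log ?_ (sum_exp_pos _).ne'
  have h : ∀ k ∈ (Finset.univ : Finset ι), HasDerivAt
      (fun t : ℝ => Real.exp ((x + Pi.single i t : ι → ℝ) k))
      (if k = i then Real.exp ((x + Pi.single i t : ι → ℝ) k) else 0) t := fun k _ => by
    by_cases hk : k = i
    · subst hk
      simpa using ((hasDerivAt_id t).const_add (x k)).exp
    · simpa [hk] using hasDerivAt_const t (Real.exp (x k))
  simpa using HasDerivAt.fun_sum h

end LogSumExp

section Semidiscrete

variable {ι Ω : Type*} [Fintype ι] [MeasurableSpace Ω]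

theorem integrable_logSumExp [Nonempty ι] {μ : Measure Ω} [IsFiniteMeasure μ] {x : Ω → ι → ℝ}
    (hx : ∀ i, Integrable (fun ω => x ω i) μ) : Integrable (fun ω => logSumExp (x ω)) μ := by
  have hm : AEStronglyMeasurable x μ :=
    (aemeasurable_pi_iff.2 fun i => (hx i).aemeasurable).aestronglyMeasurable
  refine Integrable.mono' ((integrable_const |logSumExp (0 : ι → ℝ)|).add
    (integrable_finsetSum Finset.univ fun i _ => (hx i).abs))
    (lipschitzWith_logSumExp.continuous.comp_aestronglyMeasurable hm)
    (Filter.Eventually.of_forall fun ω => ?_)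
  have h1 := lipschitzWith_logSumExp.dist_le_mul (x ω) 0
  have h2 : ‖x ω‖ ≤ ∑ i, |x ω i| := by
    refine (pi_norm_le_iff_of_nonneg (by positivity)).2 fun i => ?_
    exact Finset.single_le_sum (f := fun i => |x ω i|) (fun _ _ => abs_nonneg _)
      (Finset.mem_univ i)
  rw [dist_zero_right, NNReal.coe_one, one_mul, Real.dist_eq] at h1
  have h3 := abs_sub_abs_le_abs_sub (logSumExp (x ω)) (logSumExp (0 : ι → ℝ))
  simp only [Pi.add_apply, Real.norm_eq_abs]
  linarith

/-- There are dual weights `v` for which the associated Gibbs densities have equal mass. -/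
theorem exists_integral_softmax_eq [Nonempty ι] (μ : Measure Ω) [IsProbabilityMeasure μ]
    (c : ι → Ω → ℝ) (hc : ∀ i, Integrable (c i) μ) :
    ∃ v : ι → ℝ, ∀ i, ∫ ω, softmax (fun k => v k - c k ω) i ∂μ = 1 / Fintype.card ι := by
  classical
  set n : ℝ := (Fintype.card ι : ℝ) with hn
  have hn0 : 0 < n := by simp [hn, Fintype.card_pos]
  have hint : ∀ v : ι → ℝ, Integrable (fun ω => logSumExp fun k : ι => v k - c k ω) μ := fun v =>
    integrable_logSumExp fun i => (integrable_const (v i)).sub (hc i)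
  set I : (ι → ℝ) → ℝ := fun v => ∫ ω, logSumExp (fun k : ι => v k - c k ω) ∂μ with hI
  set F : (ι → ℝ) → ℝ := fun v => I v - (∑ i, v i) / n + (∑ i, v i) ^ 2 with hF
  have hIcont : Continuous I := by
    refine (LipschitzWith.of_le_add (f := I) fun v w => ?_).continuous
    have : I w + dist v w = ∫ ω, (logSumExp (fun k => w k - c k ω) + dist v w) ∂μ := by
      rw [integral_add (hint w) (integrable_const _)]; simp [hI]
    rw [this]
    refine integral_mono (hint v) ((hint w).add (integrable_const _)) fun ω => ?_
    refine logSumExp_le_add fun i => ?_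
    have := (le_abs_self _).trans ((Real.dist_eq _ _).symm.le.trans (dist_le_pi_dist v w i))
    linarith
  have hFcont : Continuous F := by fun_prop
  have hIge : ∀ v j, v j - ∫ ω, c j ω ∂μ ≤ I v := fun v j => by
    have : v j - ∫ ω, c j ω ∂μ = ∫ ω, (v j - c j ω) ∂μ := by
      rw [integral_sub (integrable_const _) (hc j)]; simp
    rw [this]
    exact integral_mono ((integrable_const _).sub (hc j)) (hint v)
      fun ω => le_logSumExp (fun k => v k - c k ω) j
  obtain ⟨v, hv⟩ : ∃ v, ∀ w, F v ≤ F w := by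
    set K : ℝ := |F 0| + ∑ j, |∫ ω, c j ω ∂μ| with hK
    have hK0 : 0 ≤ K := by positivity
    refine hFcont.exists_forall_le' 0 ?_
    refine Filter.mem_of_superset
      (isCompact_closedBall (0 : ι → ℝ) (n * K + K + 1)).compl_mem_cocompact fun v hv => ?_
    by_contra hlt
    simp only [Set.mem_ofPred_eq, not_le] at hlt
    refine hv ?_
    set S := ∑ i, v i with hS
    have hj : ∀ j, v j - S / n + S ^ 2 ≤ K := fun j => by
      have h1 := hIge v j
      have h2 : |∫ ω, c j ω ∂μ| ≤ ∑ j, |∫ ω, c j ω ∂μ| :=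
        Finset.single_le_sum (f := fun j => |∫ ω, c j ω ∂μ|) (fun _ _ => abs_nonneg _)
          (Finset.mem_univ j)
      have h3 := le_abs_self (F 0)
      have h4 := le_abs_self (∫ ω, c j ω ∂μ)
      have h5 : F v = I v - S / n + S ^ 2 := rfl
      linarith
    have hsum : ∑ j, (K - (v j - S / n)) = n * K := by
      simp only [Finset.sum_sub_distrib, Finset.sum_const, Finset.card_univ, nsmul_eq_mul, ← hn,
        ← hS]
      field_simp
      ring
    have hlow : ∀ j, K - (v j - S / n) ≤ n * K := fun j => by
      rw [← hsum]
      exact Finset.single_le_sum (f := fun j => K - (v j - S / n))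
        (fun i _ => by nlinarith [hj i, sq_nonneg S]) (Finset.mem_univ j)
    have hS2 : S ^ 2 ≤ K := by
      have h := Finset.sum_le_sum fun j (_ : j ∈ Finset.univ) =>
        (by linarith [hj j] : S ^ 2 ≤ K - (v j - S / n))
      rw [hsum, Finset.sum_const, Finset.card_univ, nsmul_eq_mul, ← hn] at h
      exact le_of_mul_le_mul_left h hn0
    have hn1 : 1 ≤ n := by
      rw [hn]; exact_mod_cast Fintype.card_pos (α := ι)
    have hSabs : |S / n| ≤ K + 1 := by
      rw [abs_div, abs_of_pos hn0]
      refine (div_le_self (abs_nonneg S) hn1).trans ?_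
      nlinarith [sq_abs S, sq_nonneg (|S| - 1), abs_nonneg S]
    have hnK : K ≤ n * K := by nlinarith
    rw [mem_closedBall_zero_iff, pi_norm_le_iff_of_nonneg (by positivity)]
    intro j
    rw [Real.norm_eq_abs, abs_le]
    obtain ⟨h1, h2⟩ := abs_le.1 hSabs
    constructor
    · linarith [hlow j]
    · linarith [hj j, sq_nonneg S]
  have hfint : ∀ (v : ι → ℝ) i,
      Integrable (fun ω => softmax (fun k : ι => v k - c k ω) i) μ := fun v i => by
    have hm : AEStronglyMeasurable (fun ω => fun k => v k - c k ω) μ :=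
      (aemeasurable_pi_iff.2 fun i =>
        ((integrable_const (v i)).sub (hc i)).aemeasurable).aestronglyMeasurable
    refine Integrable.mono' (integrable_const 1)
      ((continuous_softmax i).comp_aestronglyMeasurable hm)
      (Filter.Eventually.of_forall fun ω => ?_)
    rw [Real.norm_eq_abs, abs_of_nonneg (softmax_nonneg _ _)]
    exact softmax_le_one _ _
  have hderiv : ∀ i, ∫ ω, softmax (fun k : ι => v k - c k ω) i ∂μ - 1 / n + 2 * ∑ i, v i = 0 := by
    intro i
    have heq : ∀ (t : ℝ) (ω : Ω), (fun k => (v + Pi.single i t : ι → ℝ) k - c k ω) =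
        (fun k => v k - c k ω) + Pi.single i t := fun t ω => by
      ext k; simp only [Pi.add_apply]; ring
    have hsum : ∀ t : ℝ, ∑ k, (v + Pi.single i t : ι → ℝ) k = ∑ k, v k + t := fun t => by
      simp [Finset.sum_add_distrib]
    have h1 := (hasDerivAt_integral_of_dominated_loc_of_deriv_le (μ := μ) (x₀ := (0 : ℝ))
      (s := Set.univ) (bound := fun _ => 1)
      (F := fun t ω => logSumExp (fun k => (v + Pi.single i t : ι → ℝ) k - c k ω))
      (F' := fun t ω => softmax (fun k => (v + Pi.single i t : ι → ℝ) k - c k ω) i)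
      Filter.univ_mem (Filter.Eventually.of_forall fun t => (hint _).aestronglyMeasurable)
      (hint _) (hfint _ i).aestronglyMeasurable
      (Filter.Eventually.of_forall fun ω t _ => by
        rw [Real.norm_eq_abs, abs_of_nonneg (softmax_nonneg _ _)]
        exact softmax_le_one _ _)
      (integrable_const _)
      (Filter.Eventually.of_forall fun ω t _ => by
        simp only [heq]
        exact hasDerivAt_logSumExp_single _ i t)).2
    have h2 : HasDerivAt (fun t : ℝ => ∑ k, v k + t) 1 0 := (hasDerivAt_id 0).const_add _
    have h3 := (h1.fun_sub (h2.div_const n)).fun_add (h2.fun_pow 2)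
    have h4 : IsLocalMin (fun t : ℝ => F (v + Pi.single i t)) 0 :=
      Filter.Eventually.of_forall fun t => by simpa using hv _
    have h5 := h4.hasDerivAt_eq_zero (by simpa only [hF, hI, hsum] using h3)
    simpa using h5
  have hone : ∑ i, ∫ ω, softmax (fun k : ι => v k - c k ω) i ∂μ = 1 := by
    rw [← integral_finsetSum _ fun i _ => hfint v i]
    simp [sum_softmax]
  have hS : ∑ i, v i = 0 := by
    have h := Finset.sum_eq_zero fun i (_ : i ∈ Finset.univ) => hderiv i
    simp only [Finset.sum_add_distrib, Finset.sum_sub_distrib, hone, Finset.sum_const,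
      Finset.card_univ, nsmul_eq_mul, ← hn] at h
    rw [mul_one_div_cancel hn0.ne', sub_self, zero_add] at h
    simpa [hn0.ne'] using h
  exact ⟨v, fun i => by linarith [hderiv i]⟩

/-- Approximate primal-dual optimality for semidiscrete transport of a probability measure onto
a uniform measure on `ι`. -/
theorem exists_density_almost_optimal [Nonempty ι] (μ : Measure Ω) [IsProbabilityMeasure μ]
    (c : ι → Ω → ℝ) (hcm : ∀ i, Measurable (c i)) (hc : ∀ i, Integrable (c i) μ)
    {ε : ℝ} (hε : 0 < ε) :
    ∃ (v : ι → ℝ) (f : ι → Ω → ℝ), (∀ i, Measurable (f i)) ∧ (∀ i ω, 0 ≤ f i ω) ∧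
      (∀ ω, ∑ i, f i ω = 1) ∧ (∀ i, ∫ ω, f i ω ∂μ = 1 / Fintype.card ι) ∧
      ∀ ω j, ∑ i, f i ω * (c i ω - v i) ≤ c j ω - v j + ε := by
  set n : ℝ := (Fintype.card ι : ℝ) with hn
  have hn0 : 0 < n := by simp [hn, Fintype.card_pos]
  set δ : ℝ := ε / n with hδ
  have hδ0 : 0 < δ := div_pos hε hn0
  obtain ⟨v, hv⟩ := exists_integral_softmax_eq μ (fun i ω => c i ω / δ)
    fun i => (hc i).div_const δ
  refine ⟨fun i => δ * v i, fun i ω => softmax (fun k : ι => v k - c k ω / δ) i, fun i => ?_,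
    fun i ω => softmax_nonneg _ _, fun ω => sum_softmax _, hv, fun ω j => ?_⟩
  · exact (continuous_softmax i).measurable.comp
      (measurable_pi_iff.2 fun k => measurable_const.sub ((hcm k).div_const δ))
  · have h := mul_le_mul_of_nonneg_left
      (le_sum_softmax_mul_add_card (fun k => v k - c k ω / δ) j) hδ0.le
    rw [mul_add, ← hn, hδ, div_mul_cancel₀ _ hn0.ne', ← hδ, mul_sub, mul_div_cancel₀ _ hδ0.ne',
      Finset.mul_sum] at h
    have h2 : ∑ i, softmax (fun k : ι => v k - c k ω / δ) i * (c i ω - δ * v i) =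
        - ∑ i, δ * (softmax (fun k : ι => v k - c k ω / δ) i * (v i - c i ω / δ)) := by
      rw [← Finset.sum_neg_distrib]
      refine Finset.sum_congr rfl fun i _ => ?_
      rw [mul_left_comm, ← mul_neg, ← mul_neg, neg_sub, mul_sub δ, mul_div_cancel₀ _ hδ0.ne']
    rw [h2]
    linarith

end Semidiscrete

section Transport

variable {α : Type*} [MeasurableSpace α]

theorem ofReal_integral_le_lintegral_of_ae_le {κ : Measure α} {g h : α → ℝ}
    (hg : Integrable g κ) (hle : g ≤ᵐ[κ] h) :
    ENNReal.ofReal (∫ x, g x ∂κ) ≤ ∫⁻ x, ENNReal.ofReal (h x) ∂κ := by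
  calc ENNReal.ofReal (∫ x, g x ∂κ) ≤ ENNReal.ofReal (∫ x, max (g x) 0 ∂κ) :=
        ENNReal.ofReal_le_ofReal (integral_mono hg hg.pos_part fun x => le_max_left _ _)
    _ = ∫⁻ x, ENNReal.ofReal (max (g x) 0) ∂κ :=
        ofReal_integral_eq_lintegral_ofReal hg.pos_part
          (Filter.Eventually.of_forall fun x => le_max_right _ _)
    _ ≤ ∫⁻ x, ENNReal.ofReal (h x) ∂κ := by
        refine lintegral_mono_ae (hle.mono fun x hx => ?_)
        rw [ENNReal.ofReal_max, ENNReal.ofReal_zero, max_eq_left zero_le]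
        exact ENNReal.ofReal_le_ofReal hx

/-- Weak duality for transport onto an empirical measure. -/
theorem ofReal_dual_le_lintegral_cost [MeasurableSingletonClass α] {N : ℕ} (hN : 0 < N)
    (y : Fin N → α) {c : α → α → ℝ} {μ : Measure α} {κ : Measure (α × α)}
    (hfst : κ.map Prod.fst = μ)
    (hsnd : κ.map Prod.snd = ((N : ℝ≥0∞))⁻¹ • ∑ i, Measure.dirac (y i))
    {φ ψ : α → ℝ} (hφ : Integrable φ μ) (hle : ∀ x i, φ x + ψ (y i) ≤ c x (y i)) :
    ENNReal.ofReal (∫ x, φ x ∂μ + 1 / N * ∑ i, ψ (y i)) ≤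
      ∫⁻ q, ENNReal.ofReal (c q.1 q.2) ∂κ := by
  have hN0 : (N : ℝ≥0∞)⁻¹ ≠ ∞ := by simp [hN.ne']
  set ψ' : α → ℝ := (Set.range y).indicator ψ with hψ'
  have hy : ∀ i, ψ' (y i) = ψ (y i) := fun i => Set.indicator_of_mem (Set.mem_range_self i) ψ
  have hψm : Measurable ψ' := by
    refine (measurable_const (a := (0 : ℝ))).measurable_of_countable_ne ?_
    refine (Set.finite_range y).countable.mono fun x hx => ?_
    by_contra hx'
    exact hx (Set.indicator_of_notMem hx' ψ).symm
  have hψi : ∀ i ∈ (Finset.univ : Finset (Fin N)), Integrable ψ' (Measure.dirac (y i)) :=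
    fun i _ => integrable_dirac (by simp)
  have hψint : Integrable ψ' (κ.map Prod.snd) := by
    rw [hsnd]
    exact (integrable_finsetSum_measure.2 hψi).smul_measure hN0
  have hψval : ∫ x, ψ' x ∂(κ.map Prod.snd) = 1 / N * ∑ i, ψ (y i) := by
    rw [hsnd, integral_smul_measure, integral_finsetSum_measure hψi]
    simp [hy]
  have hφκ : Integrable (fun q : α × α => φ q.1) κ := by
    rw [← hfst] at hφ; exact hφ.comp_measurable measurable_fst
  have hψκ : Integrable (fun q : α × α => ψ' q.2) κ := hψint.comp_measurable measurable_snd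
  have hval : ∫ q, (φ q.1 + ψ' q.2) ∂κ = ∫ x, φ x ∂μ + 1 / N * ∑ i, ψ (y i) := by
    rw [integral_add hφκ hψκ, ← hψval, integral_map measurable_snd.aemeasurable
      hψm.aestronglyMeasurable, ← hfst, integral_map measurable_fst.aemeasurable
      (hfst ▸ hφ.aestronglyMeasurable)]
  rw [← hval]
  refine ofReal_integral_le_lintegral_of_ae_le (hφκ.add hψκ) ?_
  have hr : ∀ᵐ x ∂(κ.map Prod.snd), x ∈ Set.range y := by
    have hz : (κ.map Prod.snd) (Set.range y)ᶜ = 0 := by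
      rw [hsnd]
      simp
    exact hz
  filter_upwards [ae_of_ae_map measurable_snd.aemeasurable hr] with q hq
  obtain ⟨i, hi⟩ := hq
  rw [← hi, hy]
  exact hle q.1 i

/-- Densities `f i` summing to one and of mass `1 / N` induce a coupling with the empirical
measure, with the expected cost. -/
theorem exists_coupling_of_density {N : ℕ} (hN : 0 < N) (y : Fin N → α) {c : α → α → ℝ}
    (hcm : Measurable fun q : α × α => c q.1 q.2) (hc0 : ∀ x y, 0 ≤ c x y)
    {μ : Measure α} [IsProbabilityMeasure μ] (hc : ∀ i, Integrable (fun x => c x (y i)) μ)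
    {f : Fin N → α → ℝ} (hfm : ∀ i, Measurable (f i)) (hf0 : ∀ i x, 0 ≤ f i x)
    (hf1 : ∀ x, ∑ i, f i x = 1) (hfN : ∀ i, ∫ x, f i x ∂μ = 1 / N) :
    ∃ κ : Measure (α × α), IsProbabilityMeasure κ ∧ κ.map Prod.fst = μ ∧
      κ.map Prod.snd = ((N : ℝ≥0∞))⁻¹ • ∑ i, Measure.dirac (y i) ∧
      ∫⁻ q, ENNReal.ofReal (c q.1 q.2) ∂κ =
        ENNReal.ofReal (∫ x, ∑ i, f i x * c x (y i) ∂μ) := by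
  have hle1 : ∀ i x, f i x ≤ 1 := fun i x => by
    rw [← hf1 x]
    exact Finset.single_le_sum (f := fun i => f i x) (fun i _ => hf0 i x) (Finset.mem_univ i)
  have hfi : ∀ i, Integrable (f i) μ := fun i =>
    Integrable.mono' (integrable_const 1) (hfm i).aestronglyMeasurable
      (Filter.Eventually.of_forall fun x => by
        rw [Real.norm_eq_abs, abs_of_nonneg (hf0 i x)]; exact hle1 i x)
  have hpair : ∀ i, Measurable fun x : α => (x, y i) := fun i =>
    measurable_id.prodMk measurable_const
  set κi : Fin N → Measure (α × α) := fun i =>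
    (μ.withDensity fun x => ENNReal.ofReal (f i x)).map fun x => (x, y i) with hκi
  have hfst : (∑ i, κi i).map Prod.fst = μ := by
    ext s hs
    rw [Measure.map_apply measurable_fst hs, Measure.finsetSum_apply]
    have h : ∀ i, κi i (Prod.fst ⁻¹' s) = ∫⁻ x in s, ENNReal.ofReal (f i x) ∂μ := fun i => by
      rw [Measure.map_apply (hpair i) (measurable_fst hs), ← withDensity_apply _ hs]
      rfl
    simp_rw [h]
    rw [← lintegral_finsetSum _ fun i _ => (hfm i).ennreal_ofReal]
    simp_rw [← ENNReal.ofReal_sum_of_nonneg fun i _ => hf0 i _, hf1]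
    simp
  have hsnd : (∑ i, κi i).map Prod.snd = ((N : ℝ≥0∞))⁻¹ • ∑ i, Measure.dirac (y i) := by
    ext s hs
    rw [Measure.map_apply measurable_snd hs, Measure.finsetSum_apply, Measure.smul_apply,
      Measure.finsetSum_apply, smul_eq_mul, Finset.mul_sum]
    refine Finset.sum_congr rfl fun i _ => ?_
    rw [Measure.map_apply (hpair i) (measurable_snd hs), Measure.dirac_apply' _ hs]
    by_cases hi : y i ∈ s
    · have : (fun x => (x, y i)) ⁻¹' (Prod.snd ⁻¹' s) = (Set.univ : Set α) := by
        ext x; simp [hi]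
      rw [this, withDensity_apply _ MeasurableSet.univ, Measure.restrict_univ,
        ← ofReal_integral_eq_lintegral_ofReal (hfi i)
          (Filter.Eventually.of_forall (hf0 i)), hfN, one_div,
        ENNReal.ofReal_inv_of_pos (by exact_mod_cast hN), ENNReal.ofReal_natCast]
      simp [hi]
    · have : (fun x => (x, y i)) ⁻¹' (Prod.snd ⁻¹' s) = (∅ : Set α) := by
        ext x; simp [hi]
      rw [this]
      simp [hi]
  refine ⟨∑ i, κi i, ⟨?_⟩, hfst, hsnd, ?_⟩
  · have := congrArg (fun m => m Set.univ) hfst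
    simpa [Measure.map_apply measurable_fst MeasurableSet.univ] using this
  · rw [lintegral_finsetSum_measure, integral_finsetSum, ENNReal.ofReal_sum_of_nonneg]
    · refine Finset.sum_congr rfl fun i _ => ?_
      have hci : Measurable fun x => c x (y i) := hcm.comp (hpair i)
      rw [lintegral_map hcm.ennreal_ofReal (hpair i), lintegral_withDensity_eq_lintegral_mul _
        (hfm i).ennreal_ofReal hci.ennreal_ofReal, ofReal_integral_eq_lintegral_ofReal]
      · refine lintegral_congr fun x => ?_
        rw [ENNReal.ofReal_mul (hf0 i x)]; rfl
      · exact (hc i).bdd_mul (hfm i).aestronglyMeasurable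
          (Filter.Eventually.of_forall fun x => by
            rw [Real.norm_eq_abs, abs_of_nonneg (hf0 i x)]; exact hle1 i x)
      · exact Filter.Eventually.of_forall fun x => mul_nonneg (hf0 i x) (hc0 _ _)
    · exact fun i _ => integral_nonneg fun x => mul_nonneg (hf0 i x) (hc0 _ _)
    · exact fun i _ => (hc i).bdd_mul (hfm i).aestronglyMeasurable
          (Filter.Eventually.of_forall fun x => by
            rw [Real.norm_eq_abs, abs_of_nonneg (hf0 i x)]; exact hle1 i x)

/-- If all bounded functions below a nonnegative `m` have integral at most `B`, then `m` is
integrable. -/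
theorem integrable_of_integral_min_le {μ : Measure α} [IsFiniteMeasure μ] {m : α → ℝ}
    (hm : Measurable m) (hm0 : ∀ x, 0 ≤ m x) {B : ℝ}
    (h : ∀ n : ℕ, ∫ x, min (n : ℝ) (m x) ∂μ ≤ B) : Integrable m μ := by
  refine ⟨hm.aestronglyMeasurable, ?_⟩
  rw [hasFiniteIntegral_iff_ofReal (Filter.Eventually.of_forall hm0)]
  have hsup : ∀ x, ENNReal.ofReal (m x) = ⨆ n : ℕ, ENNReal.ofReal (min (n : ℝ) (m x)) :=
    fun x => by
      refine le_antisymm ?_ (iSup_le fun n => ENNReal.ofReal_le_ofReal (min_le_right _ _))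
      obtain ⟨n, hn⟩ := exists_nat_ge (m x)
      exact le_iSup_of_le n (by rw [min_eq_right hn])
  simp_rw [hsup]
  rw [lintegral_iSup (fun n => (measurable_const.min hm).ennreal_ofReal)
    fun a b hab x => ENNReal.ofReal_le_ofReal (min_le_min_right _ (by exact_mod_cast hab))]
  refine lt_of_le_of_lt (iSup_le fun n => ?_) (ENNReal.ofReal_lt_top (r := B))
  have h0 : ∀ x, 0 ≤ min (n : ℝ) (m x) := fun x => le_min (Nat.cast_nonneg n) (hm0 x)
  rw [← ofReal_integral_eq_lintegral_ofReal _ (Filter.Eventually.of_forall h0)]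
  · exact ENNReal.ofReal_le_ofReal (h n)
  · exact Integrable.mono' (integrable_const (n : ℝ)) (measurable_const.min hm).aestronglyMeasurable
      (Filter.Eventually.of_forall fun x => by
        rw [Real.norm_eq_abs, abs_of_nonneg (h0 x)]; exact min_le_left _ _)

/-- Strong duality for transport onto an empirical measure, for costs that are comparable
up to additive and multiplicative constants. -/
theorem exists_coupling_lintegral_le {N : ℕ} (hN : 0 < N) (y : Fin N → α) {c : α → α → ℝ}
    (hcm : Measurable fun q : α × α => c q.1 q.2) (hc0 : ∀ x y, 0 ≤ c x y) {A D : ℝ}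
    (hcomp : ∀ x i j, c x (y j) ≤ A * (c x (y i) + D))
    {μ : Measure α} [IsProbabilityMeasure μ] {B : ℝ}
    (hdual : ∀ (φ : α → ℝ) (v : Fin N → ℝ), Measurable φ → Integrable φ μ →
      (∀ x i, φ x + v i ≤ c x (y i)) → ∫ x, φ x ∂μ + 1 / N * ∑ i, v i ≤ B)
    {ε : ℝ} (hε : 0 < ε) :
    ∃ κ : Measure (α × α), IsProbabilityMeasure κ ∧ κ.map Prod.fst = μ ∧
      κ.map Prod.snd = ((N : ℝ≥0∞))⁻¹ • ∑ i, Measure.dirac (y i) ∧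
      ∫⁻ q, ENNReal.ofReal (c q.1 q.2) ∂κ ≤ ENNReal.ofReal (B + ε) := by
  have : Nonempty (Fin N) := ⟨⟨0, hN⟩⟩
  have hci : ∀ i, Measurable fun x => c x (y i) := fun i =>
    hcm.comp (measurable_id.prodMk measurable_const)
  have hinf : ∀ v : Fin N → ℝ, Measurable fun x =>
      Finset.univ.inf' Finset.univ_nonempty fun i => c x (y i) - v i := fun v => by
    have h : Measurable (Finset.univ.inf' Finset.univ_nonempty fun i x => c x (y i) - v i) :=
      Finset.inf'_induction _ _ (fun _ hf _ hg => hf.inf hg) fun i _ => (hci i).sub_const _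
    convert h using 1
    ext x
    simp
  have hmi : Integrable (fun x => Finset.univ.inf' Finset.univ_nonempty fun i => c x (y i)) μ := by
    have hm : Measurable fun x => Finset.univ.inf' Finset.univ_nonempty fun i => c x (y i) := by
      simpa using hinf 0
    have hm0 : ∀ x, 0 ≤ Finset.univ.inf' Finset.univ_nonempty fun i => c x (y i) := fun x =>
      Finset.le_inf' _ _ fun i _ => hc0 _ _
    refine integrable_of_integral_min_le hm hm0 (B := B) fun n => ?_
    have := hdual (fun x => min (n : ℝ) (Finset.univ.inf' Finset.univ_nonempty
      fun i => c x (y i))) 0 (measurable_const.min hm)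
      (Integrable.mono' (integrable_const (n : ℝ)) (measurable_const.min hm).aestronglyMeasurable
        (Filter.Eventually.of_forall fun x => by
          rw [Real.norm_eq_abs, abs_of_nonneg (le_min (Nat.cast_nonneg n) (hm0 x))]
          exact min_le_left _ _))
      fun x i => by
        simp only [Pi.zero_apply, add_zero]
        exact (min_le_right _ _).trans (Finset.inf'_le _ (Finset.mem_univ i))
    simpa using this
  have hc : ∀ i, Integrable (fun x => c x (y i)) μ := fun j =>
    Integrable.mono' ((hmi.add (integrable_const D)).const_mul A) (hci j).aestronglyMeasurable
      (Filter.Eventually.of_forall fun x => by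
        rw [Real.norm_eq_abs, abs_of_nonneg (hc0 _ _)]
        obtain ⟨i, -, hi⟩ := Finset.exists_mem_eq_inf' (Finset.univ_nonempty (α := Fin N))
          fun i => c x (y i)
        simp only [Pi.add_apply]
        rw [hi]
        exact hcomp x i j)
  obtain ⟨v, f, hfm, hf0, hf1, hfN, hopt⟩ :=
    exists_density_almost_optimal μ (fun i x => c x (y i)) hci hc hε
  rw [Fintype.card_fin] at hfN
  obtain ⟨κ, hκ, hfst, hsnd, hcost⟩ := exists_coupling_of_density hN y hcm hc0 hc hfm hf0 hf1 hfN
  refine ⟨κ, hκ, hfst, hsnd, hcost.trans_le (ENNReal.ofReal_le_ofReal ?_)⟩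
  set φ : α → ℝ := fun x => Finset.univ.inf' Finset.univ_nonempty fun i => c x (y i) - v i with hφ
  have hle1 : ∀ i x, ‖f i x‖ ≤ 1 := fun i x => by
    rw [Real.norm_eq_abs, abs_of_nonneg (hf0 i x), ← hf1 x]
    exact Finset.single_le_sum (f := fun i => f i x) (fun i _ => hf0 i x) (Finset.mem_univ i)
  have hfi : ∀ i, Integrable (f i) μ := fun i =>
    Integrable.mono' (integrable_const 1) (hfm i).aestronglyMeasurable
      (Filter.Eventually.of_forall (hle1 i))
  have hfc : ∀ i, Integrable (fun x => f i x * c x (y i)) μ := fun i =>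
    (hc i).bdd_mul (hfm i).aestronglyMeasurable (Filter.Eventually.of_forall (hle1 i))
  have hφi : Integrable φ μ := by
    refine Integrable.mono' (integrable_finsetSum Finset.univ fun i _ =>
      ((hc i).sub (integrable_const (v i))).abs) (hinf v).aestronglyMeasurable
      (Filter.Eventually.of_forall fun x => ?_)
    obtain ⟨i, -, hi⟩ := Finset.exists_mem_eq_inf' (Finset.univ_nonempty (α := Fin N))
      fun i => c x (y i) - v i
    simp only [hφ]
    rw [hi, Real.norm_eq_abs]
    exact Finset.single_le_sum (f := fun i => |c x (y i) - v i|) (fun _ _ => abs_nonneg _)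
      (Finset.mem_univ i)
  have hd := hdual φ v (hinf v) hφi fun x i => by
    have := Finset.inf'_le (fun i => c x (y i) - v i) (Finset.mem_univ i)
    simp only [hφ]
    linarith
  have hpt : ∀ x, ∑ i, f i x * c x (y i) ≤ φ x + ε + ∑ i, f i x * v i := fun x => by
    obtain ⟨j, -, hj⟩ := Finset.exists_mem_eq_inf' (Finset.univ_nonempty (α := Fin N))
      fun i => c x (y i) - v i
    have h := hopt x j
    simp only [mul_sub, Finset.sum_sub_distrib] at h
    simp only [hφ]
    rw [hj]
    linarith
  have hfv : Integrable (fun x => ∑ i, f i x * v i) μ :=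
    integrable_finsetSum _ fun i _ => (hfi i).mul_const _
  have hint := integral_mono (integrable_finsetSum Finset.univ fun i _ => hfc i)
    ((hφi.add (integrable_const ε)).add hfv) hpt
  refine hint.trans ?_
  have h1 : ∫ x, ∑ i, f i x * v i ∂μ = 1 / N * ∑ i, v i := by
    rw [integral_finsetSum _ fun i _ => (hfi i).mul_const _, Finset.mul_sum]
    exact Finset.sum_congr rfl fun i _ => by rw [integral_mul_const, hfN]
  have h2 : ∫ x, (φ x + ε + ∑ i, f i x * v i) ∂μ = ∫ x, φ x ∂μ + ε + 1 / N * ∑ i, v i := by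
    rw [integral_add (f := fun x => φ x + ε) (hφi.add (integrable_const ε)) hfv, h1,
      integral_add hφi (integrable_const ε)]
    simp
  exact h2.le.trans (by linarith)

end Transport

theorem Real.rpow_le_two_rpow_mul_add {a b s p : ℝ} (hs : 0 ≤ s) (ha : 0 ≤ a) (hb : 0 ≤ b)
    (h : s ≤ a + b) (hp : 0 ≤ p) : s ^ p ≤ 2 ^ p * (a ^ p + b ^ p) := by
  have hm : s ≤ 2 * max a b := by linarith [le_max_left a b, le_max_right a b]
  have hab : max a b ^ p ≤ a ^ p + b ^ p := by
    rcases max_choice a b with h | h <;> rw [h] <;>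
      linarith [Real.rpow_nonneg ha p, Real.rpow_nonneg hb p]
  calc s ^ p ≤ (2 * max a b) ^ p := Real.rpow_le_rpow hs hm hp
    _ = 2 ^ p * max a b ^ p := Real.mul_rpow (by norm_num) (le_max_of_le_left ha)
    _ ≤ _ := mul_le_mul_of_nonneg_left hab (by positivity)

theorem EReal.coe_finsetSum {ι : Type*} (s : Finset ι) (f : ι → ℝ) :
    ((∑ i ∈ s, f i : ℝ) : EReal) = ∑ i ∈ s, (f i : EReal) := by
  classical
  induction s using Finset.induction_on with
  | empty => simp
  | insert a s ha ih => rw [Finset.sum_insert ha, Finset.sum_insert ha, EReal.coe_add, ih]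

theorem EReal.sum_eq_bot {ι : Type*} {s : Finset ι} {f : ι → EReal} {i : ι} (hi : i ∈ s)
    (h : f i = ⊥) : ∑ j ∈ s, f j = ⊥ := by
  classical
  rw [← Finset.add_sum_erase s f hi, h, EReal.bot_add]

/-- Lemma 1, reformulation of the Wasserstein ball via Kantorovich duality:
for a closed `W ⊆ ℝ^l` with a continuous metric `d`, `p ∈ [1,∞)`, samples `ŵ⁽¹⁾,…,ŵ⁽ᴺ⁾`,
empirical measure `ν_N` and radius `θ > 0`, a Borel probability measure `μ` on `W` satisfies
`W_p(μ, ν_N) ≤ θ` iff for every Borel-measurable `μ`-integrable `φ : W → ℝ`,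
`∫ φ dμ + (1/N) ∑ᵢ inf_w [d(w,ŵ⁽ⁱ⁾)^p − φ(w)] ≤ θ^p` in the extended reals. -/
theorem wasserstein_ball_kantorovich_duality
    {l : ℕ} (W : Set (Fin l → ℝ)) (hWclosed : IsClosed W)
    (d : ↥W → ↥W → ℝ)
    (hd_cont : Continuous fun q : ↥W × ↥W => d q.1 q.2)
    (hd_nonneg : ∀ w w', 0 ≤ d w w')
    (hd_eq_zero : ∀ w w', d w w' = 0 ↔ w = w')
    (hd_symm : ∀ w w', d w w' = d w' w)
    (hd_triangle : ∀ w w' w'', d w w'' ≤ d w w' + d w' w'')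
    (p : ℝ) (hp : 1 ≤ p)
    (N : ℕ) (hN : 0 < N) (what : Fin N → ↥W)
    (ν : Measure ↥W) (hν : ν = ((N : ℝ≥0∞))⁻¹ • ∑ i, Measure.dirac (what i))
    (θ : ℝ) (hθ : 0 < θ)
    (μ : Measure ↥W) (hμ : IsProbabilityMeasure μ) :
    Wdist d p μ ν ≤ ENNReal.ofReal θ ↔
      ∀ φ : ↥W → ℝ, Measurable φ → Integrable φ μ →
        ((∫ w, φ w ∂μ : ℝ) : EReal)
            + ((1 / N : ℝ) : EReal)
              * ∑ i, ⨅ w : ↥W, ((d w (what i) ^ p - φ w : ℝ) : EReal)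
          ≤ ((θ ^ p : ℝ) : EReal) := by
  have : Nonempty (Fin N) := ⟨⟨0, hN⟩⟩
  have hp0 : 0 < p := by linarith
  have hNr : (0 : ℝ) < 1 / N := by positivity
  have hcm : Measurable fun q : ↥W × ↥W => d q.1 q.2 ^ p :=
    hd_cont.measurable.pow_const p
  subst hν
  constructor
  · intro hW φ _ hφ
    by_cases hbot : ∃ i, (⨅ w : ↥W, ((d w (what i) ^ p - φ w : ℝ) : EReal)) = ⊥
    · obtain ⟨i, hi⟩ := hbot
      rw [EReal.sum_eq_bot (Finset.mem_univ i) hi, EReal.coe_mul_bot_of_pos hNr, EReal.add_bot]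
      exact bot_le
    push Not at hbot
    set ψ : ↥W → ℝ := fun y => (⨅ w : ↥W, ((d w y ^ p - φ w : ℝ) : EReal)).toReal with hψ
    have hψe : ∀ i, (⨅ w : ↥W, ((d w (what i) ^ p - φ w : ℝ) : EReal)) = (ψ (what i) : EReal) :=
      fun i => (EReal.coe_toReal (ne_top_of_le_ne_top (EReal.coe_ne_top _)
        (iInf_le _ (what i))) (hbot i)).symm
    have hle : ∀ x i, φ x + ψ (what i) ≤ d x (what i) ^ p := fun x i => by
      have h : (ψ (what i) : EReal) ≤ ((d x (what i) ^ p - φ x : ℝ) : EReal) :=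
        (hψe i).symm.le.trans (iInf_le _ x)
      linarith [EReal.coe_le_coe_iff.1 h]
    simp_rw [hψe]
    rw [← EReal.coe_finsetSum, ← EReal.coe_mul, ← EReal.coe_add, EReal.coe_le_coe_iff]
    rw [← ENNReal.ofReal_le_ofReal_iff (by positivity),
      ← ENNReal.ofReal_rpow_of_nonneg hθ.le hp0.le, ← ENNReal.rpow_inv_le_iff hp0, ← one_div]
    refine le_trans (le_iInf₂ fun κ hκ => ?_) hW
    exact ENNReal.rpow_le_rpow (ofReal_dual_le_lintegral_cost hN what
      (c := fun x y => d x y ^ p) (ψ := ψ) hκ.2.1 hκ.2.2 hφ hle)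
      (by positivity)
  · intro h
    have hdual : ∀ (φ : ↥W → ℝ) (v : Fin N → ℝ), Measurable φ → Integrable φ μ →
        (∀ x i, φ x + v i ≤ d x (what i) ^ p) →
        ∫ x, φ x ∂μ + 1 / N * ∑ i, v i ≤ θ ^ p := fun φ v hφm hφ hle => by
      rw [← EReal.coe_le_coe_iff, EReal.coe_add, EReal.coe_mul, EReal.coe_finsetSum]
      refine le_trans ?_ (h φ hφm hφ)
      gcongr with i
      · exact le_iInf fun w => EReal.coe_le_coe_iff.2 (by linarith [hle w i])
    obtain ⟨D, hD⟩ : ∃ D, ∀ i j, d (what i) (what j) ^ p ≤ D := by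
      obtain ⟨D, hD⟩ := (Set.finite_range fun q : Fin N × Fin N =>
        d (what q.1) (what q.2) ^ p).bddAbove
      exact ⟨D, fun i j => hD ⟨(i, j), rfl⟩⟩
    have hcomp : ∀ x i j, d x (what j) ^ p ≤ 2 ^ p * (d x (what i) ^ p + D) := fun x i j =>
      (Real.rpow_le_two_rpow_mul_add (hd_nonneg _ _) (hd_nonneg _ _) (hd_nonneg _ _)
        (hd_triangle x (what i) (what j)) hp0.le).trans
        (mul_le_mul_of_nonneg_left (by linarith [hD i j]) (by positivity))
    rw [← ENNReal.rpow_le_rpow_iff hp0, ENNReal.ofReal_rpow_of_nonneg hθ.le hp0.le]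
    refine ENNReal.le_of_forall_pos_le_add fun ε hε _ => ?_
    obtain ⟨κ, hκ, hfst, hsnd, hcost⟩ := exists_coupling_lintegral_le hN what
      (c := fun x y => d x y ^ p) hcm (fun x y => Real.rpow_nonneg (hd_nonneg x y) p) hcomp hdual
      (NNReal.coe_pos.2 hε)
    rw [ENNReal.ofReal_add (by positivity) ε.coe_nonneg, ENNReal.ofReal_coe_nnreal] at hcost
    refine le_trans ?_ hcost
    rw [← ENNReal.le_rpow_inv_iff hp0, ← one_div p]
    have hmem : κ ∈ {κ : Measure (↥W × ↥W) | IsProbabilityMeasure κ ∧ κ.map Prod.fst = μ ∧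
        κ.map Prod.snd = ((N : ℝ≥0∞))⁻¹ • ∑ i, Measure.dirac (what i)} := ⟨hκ, hfst, hsnd⟩
    unfold Wdist
    exact iInf_le_of_le κ (iInf_le_of_le hmem le_rfl)
end

section
/- Under the standing assumptions, for all functions v, v' : X → ℝ that are Borel-measurable with ‖v‖_ξ < ∞ and ‖v'‖_ξ < ∞, the Bellman operator T satisfies ‖T v − T v'‖_ξ ≤ τ ‖v − v'‖_ξ, where τ := αβ ∈ (0,1); moreover T is monotone: if v(x) ≤ v'(x) for all x ∈ X, then (T v)(x) ≤ (T v')(x) for all x ∈ X. -/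
open MeasureTheory

/-- The weighted sup-norm `‖g‖_ξ := sup_x |g(x)| / ξ(x)`. -/
noncomputable def wnorm {X : Type*} (ξ : X → ℝ) (g : X → ℝ) : ℝ :=
  ⨆ x, |g x| / ξ x

/-- The distributionally robust Bellman operator
`(T v)(x) := inf_{u ∈ U(x)} sup_{μ ∈ D} [ c(x,u) + α ∫ v(f(x,u,w)) μ(dw) ]`. -/
noncomputable def Tbell {X U W : Type*} [MeasurableSpace W]
    (f : X → U → W → X) (c : X → U → ℝ) (α : ℝ)
    (Uadm : X → Set U) (D : Set (Measure W)) (v : X → ℝ) (x : X) : ℝ :=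
  ⨅ u : Uadm x, ⨆ μ : D, c x u + α * ∫ w, v (f x u w) ∂(μ : Measure W)

/-- A uniform bound `F ≤ G + d` passes to the values of the `inf sup` problems. -/
theorem ciInf_ciSup_le_add {ι κ : Type*} [Nonempty ι] [Nonempty κ] {F G : ι → κ → ℝ}
    {L M d : ℝ} (hL : ∀ i k, |F i k| ≤ L) (hM : ∀ i k, |G i k| ≤ M)
    (h : ∀ i k, F i k ≤ G i k + d) :
    ⨅ i, ⨆ k, F i k ≤ (⨅ i, ⨆ k, G i k) + d := by
  have hF : BddBelow (Set.range fun i => ⨆ k, F i k) := by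
    refine ⟨-L, ?_⟩
    rintro _ ⟨i, rfl⟩
    obtain ⟨k⟩ := ‹Nonempty κ›
    have hbdd : BddAbove (Set.range (F i)) :=
      ⟨L, by rintro _ ⟨k, rfl⟩; exact (abs_le.1 (hL i k)).2⟩
    exact (abs_le.1 (hL i k)).1.trans (le_ciSup hbdd k)
  rw [← sub_le_iff_le_add]
  refine le_ciInf fun i => ?_
  rw [sub_le_iff_le_add]
  refine (ciInf_le hF i).trans (ciSup_le fun k => (h i k).trans ?_)
  have hbdd : BddAbove (Set.range (G i)) :=
    ⟨M, by rintro _ ⟨k, rfl⟩; exact (abs_le.1 (hM i k)).2⟩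
  gcongr
  exact le_ciSup hbdd k

theorem abs_le_mul_of_bddAbove {X : Type*} {ξ g : X → ℝ} (hξ : ∀ x, 0 < ξ x)
    (hg : BddAbove (Set.range fun x => |g x| / ξ x)) (x : X) :
    |g x| ≤ wnorm ξ g * ξ x :=
  (div_le_iff₀ (hξ x)).1 (le_ciSup hg x)

theorem wnorm_nonneg {X : Type*} {ξ : X → ℝ} (hξ : ∀ x, 0 < ξ x) (g : X → ℝ) :
    0 ≤ wnorm ξ g :=
  Real.iSup_nonneg fun x => div_nonneg (abs_nonneg _) (hξ x).le

theorem bddAbove_weighted_sub {X : Type*} {ξ g h : X → ℝ} (hξ : ∀ x, 0 < ξ x)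
    (hg : BddAbove (Set.range fun x => |g x| / ξ x))
    (hh : BddAbove (Set.range fun x => |h x| / ξ x)) :
    BddAbove (Set.range fun x => |g x - h x| / ξ x) := by
  refine ⟨wnorm ξ g + wnorm ξ h, ?_⟩
  rintro _ ⟨x, rfl⟩
  refine (div_le_iff₀ (hξ x)).2 ((abs_sub _ _).trans ?_)
  rw [add_mul]
  exact add_le_add (abs_le_mul_of_bddAbove hξ hg x) (abs_le_mul_of_bddAbove hξ hh x)

/-- One-sided form of the contraction estimate: if `v ≤ v' + K ξ` then
`T v ≤ T v' + α β K ξ`. -/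
theorem Tbell_le_add {X U W : Type*} [MeasurableSpace X] [MeasurableSpace W]
    {f : X → U → W → X} (hf : ∀ x u, Measurable (f x u))
    {c : X → U → ℝ} {α : ℝ} (hα : 0 ≤ α)
    {Uadm : X → Set U} {D : Set (Measure W)} (hDne : D.Nonempty)
    {ξ : X → ℝ} {b β : ℝ} {x : X} (hUne : (Uadm x).Nonempty)
    (hcb : ∀ u ∈ Uadm x, |c x u| ≤ b * ξ x)
    (hξint : ∀ u ∈ Uadm x, ∀ μ ∈ D, Integrable (fun w => ξ (f x u w)) μ)
    (hξbound : ∀ u ∈ Uadm x, ∀ μ ∈ D, ∫ w, ξ (f x u w) ∂μ ≤ β * ξ x)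
    {v v' : X → ℝ} (hvm : Measurable v) (hv'm : Measurable v')
    {C C' K : ℝ} (hC : 0 ≤ C) (hC' : 0 ≤ C') (hK : 0 ≤ K)
    (hv : ∀ y, |v y| ≤ C * ξ y) (hv' : ∀ y, |v' y| ≤ C' * ξ y)
    (hvv' : ∀ y, v y ≤ v' y + K * ξ y) :
    Tbell f c α Uadm D v x ≤ Tbell f c α Uadm D v' x + α * β * K * ξ x := by
  have : Nonempty (Uadm x) := hUne.to_subtype
  have : Nonempty D := hDne.to_subtype
  have hint : ∀ {g : X → ℝ} {B : ℝ}, Measurable g → (∀ y, |g y| ≤ B * ξ y) →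
      ∀ u ∈ Uadm x, ∀ μ ∈ D, Integrable (fun w => g (f x u w)) μ :=
    fun hgm hg u hu μ hμ => ((hξint u hu μ hμ).const_mul _).mono'
      (hgm.comp (hf x u)).aestronglyMeasurable (.of_forall fun w => hg _)
  have hbound : ∀ {g : X → ℝ} {B : ℝ}, 0 ≤ B → (∀ y, |g y| ≤ B * ξ y) →
      ∀ (u : Uadm x) (μ : D), |c x u + α * ∫ w, g (f x u w) ∂(μ : Measure W)|
        ≤ b * ξ x + α * (B * (β * ξ x)) := by
    intro g B hB hg u μ
    refine (abs_add_le _ _).trans (add_le_add (hcb u u.2) ?_)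
    rw [abs_mul, abs_of_nonneg hα]
    gcongr
    calc |∫ w, g (f x u w) ∂(μ : Measure W)|
        ≤ ∫ w, B * ξ (f x u w) ∂(μ : Measure W) :=
          norm_integral_le_of_norm_le (f := fun w => g (f x u w))
            ((hξint u u.2 μ μ.2).const_mul B) (.of_forall fun w => hg _)
      _ ≤ B * (β * ξ x) := by
          rw [integral_const_mul]
          exact mul_le_mul_of_nonneg_left (hξbound u u.2 μ μ.2) hB
  refine ciInf_ciSup_le_add (hbound hC hv) (hbound hC' hv') fun u μ => ?_
  have hξi := (hξint u u.2 μ μ.2).const_mul K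
  have hv'i := hint hv'm hv' u u.2 μ μ.2
  have key : ∫ w, v (f x u w) ∂(μ : Measure W)
      ≤ ∫ w, v' (f x u w) ∂(μ : Measure W) + K * (β * ξ x) := by
    calc ∫ w, v (f x u w) ∂(μ : Measure W)
        ≤ ∫ w, (v' (f x u w) + K * ξ (f x u w)) ∂(μ : Measure W) :=
          integral_mono (hint hvm hv u u.2 μ μ.2) (hv'i.add hξi) fun w => hvv' _
      _ = ∫ w, v' (f x u w) ∂(μ : Measure W) + K * ∫ w, ξ (f x u w) ∂(μ : Measure W) := by
          rw [integral_add hv'i hξi, integral_const_mul]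
      _ ≤ _ := by
          gcongr
          exact hξbound u u.2 μ μ.2
  linarith [mul_le_mul_of_nonneg_left key hα]

/-- Lemma 2: contraction and monotonicity of the Bellman operator:
under the standing assumptions, for Borel-measurable `v, v'` with finite `‖·‖_ξ`-norm,
`‖T v − T v'‖_ξ ≤ τ ‖v − v'‖_ξ` with `τ := α β ∈ (0,1)`, and `T` is monotone. -/
theorem bellman_contraction_and_monotone
    {n m l : ℕ} (Xs : Set (Fin n → ℝ)) (Us : Set (Fin m → ℝ)) (Ws : Set (Fin l → ℝ))
    (hXs : MeasurableSet Xs) (hUs : MeasurableSet Us) (hWs : MeasurableSet Ws)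
    (f : ↥Xs → ↥Us → ↥Ws → ↥Xs)
    (hf : Measurable fun q : (↥Xs × ↥Us) × ↥Ws => f q.1.1 q.1.2 q.2)
    (c : ↥Xs → ↥Us → ℝ) (hc : Measurable fun q : ↥Xs × ↥Us => c q.1 q.2)
    (α : ℝ) (hα0 : 0 < α) (hα1 : α < 1)
    (Uadm : ↥Xs → Set ↥Us) (hUne : ∀ x, (Uadm x).Nonempty)
    (D : Set (Measure ↥Ws)) (hDne : D.Nonempty)
    (hDprob : ∀ μ ∈ D, IsProbabilityMeasure μ)
    (ξ : ↥Xs → ℝ) (hξm : Measurable ξ) (hξ1 : ∀ x, 1 ≤ ξ x)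
    (b β : ℝ) (hb : 0 ≤ b) (hβ1 : 1 ≤ β) (hβ : β < 1 / α)
    (hcb : ∀ x, ∀ u ∈ Uadm x, |c x u| ≤ b * ξ x)
    (hξint : ∀ x, ∀ u ∈ Uadm x, ∀ μ ∈ D, Integrable (fun w => ξ (f x u w)) μ)
    (hξbound : ∀ x, ∀ u ∈ Uadm x, ∀ μ ∈ D, ∫ w, ξ (f x u w) ∂μ ≤ β * ξ x)
    (v v' : ↥Xs → ℝ) (hvm : Measurable v) (hv'm : Measurable v')
    (hvb : BddAbove (Set.range fun x => |v x| / ξ x))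
    (hv'b : BddAbove (Set.range fun x => |v' x| / ξ x)) :
    wnorm ξ (fun x => Tbell f c α Uadm D v x - Tbell f c α Uadm D v' x)
        ≤ (α * β) * wnorm ξ (fun x => v x - v' x)
      ∧ ((∀ x, v x ≤ v' x) →
          ∀ x, Tbell f c α Uadm D v x ≤ Tbell f c α Uadm D v' x) := by
  have hξ : ∀ x, 0 < ξ x := fun x => one_pos.trans_le (hξ1 x)
  have hfm : ∀ x u, Measurable (f x u) := fun x u =>
    hf.comp (measurable_prodMk_left (x := (x, u)))
  have hbd := abs_le_mul_of_bddAbove hξ (bddAbove_weighted_sub hξ hvb hv'b)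
  have hK := wnorm_nonneg hξ fun x => v x - v' x
  have hCv := wnorm_nonneg hξ v
  have hCv' := wnorm_nonneg hξ v'
  have hv := abs_le_mul_of_bddAbove hξ hvb
  have hv' := abs_le_mul_of_bddAbove hξ hv'b
  constructor
  · refine Real.iSup_le (fun x => (div_le_iff₀ (hξ x)).2 ?_) (by positivity)
    have h₁ := Tbell_le_add hfm hα0.le hDne (hUne x) (hcb x) (hξint x) (hξbound x)
      hvm hv'm hCv hCv' hK hv hv' fun y => by linarith [(abs_le.1 (hbd y)).2]
    have h₂ := Tbell_le_add hfm hα0.le hDne (hUne x) (hcb x) (hξint x) (hξbound x)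
      hv'm hvm hCv' hCv hK hv' hv fun y => by linarith [(abs_le.1 (hbd y)).1]
    exact abs_le.2 ⟨by linarith, by linarith⟩
  · intro hle x
    simpa using Tbell_le_add hfm hα0.le hDne (hUne x) (hcb x) (hξint x) (hξbound x)
      hvm hv'm hCv hCv' le_rfl hv hv' fun y => by simpa using hle y
end

section
/- Let W be a Borel subset of ℝ^l with a metric d, p ∈ [1,∞), ŵ^(1),…,ŵ^(N) ∈ W, ν_N := (1/N) Σ_{i=1}^N δ_{ŵ^(i)}, and θ > 0. Then for every Borel-measurable function g : W → ℝ, every λ ≥ 0, and every Borel probability measure μ on W with W_p(μ, ν_N) ≤ θ and ∫_W |g| dμ < ∞, the following weak-duality inequality holds in the extended reals: ∫_W g(w) μ(dw) ≤ λ θ^p + (1/N) Σ_{i=1}^N sup_{w ∈ W} [ g(w) − λ d(w, ŵ^(i))^p ]. -/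
open MeasureTheory ENNReal

/-- The positive part of an integral is at most the integral of the positive part. -/
lemma ofReal_integral_le_lintegral_ofReal {α : Type*} [MeasurableSpace α] {μ : Measure α}
    {f : α → ℝ} (hf : Integrable f μ) :
    ENNReal.ofReal (∫ x, f x ∂μ) ≤ ∫⁻ x, ENNReal.ofReal (f x) ∂μ := by
  rw [integral_eq_lintegral_pos_part_sub_lintegral_neg_part hf]
  refine ENNReal.ofReal_le_of_le_toReal ?_
  linarith [ENNReal.toReal_nonneg (a := ∫⁻ x, ENNReal.ofReal (-f x) ∂μ)]

/-- If `f x - h y ≤ c (x, y)` almost everywhere for a coupling `κ`, then the cost of `κ` bounds the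
difference of the integrals of `f` and `h`; no measurability of the cost `c` is needed. -/
lemma ofReal_integral_sub_le_lintegral_of_coupling {α β : Type*} [MeasurableSpace α]
    [MeasurableSpace β] {κ : Measure (α × β)} {f : α → ℝ} {h : β → ℝ} {c : α × β → ℝ}
    (hf : Integrable f (κ.map Prod.fst)) (hh : Integrable h (κ.map Prod.snd))
    (hle : ∀ᵐ q ∂κ, f q.1 - h q.2 ≤ c q) :
    ENNReal.ofReal (∫ x, f x ∂(κ.map Prod.fst) - ∫ y, h y ∂(κ.map Prod.snd))
      ≤ ∫⁻ q, ENNReal.ofReal (c q) ∂κ := by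
  have hf' : Integrable (fun q : α × β => f q.1) κ := hf.comp_measurable measurable_fst
  have hh' : Integrable (fun q : α × β => h q.2) κ := hh.comp_measurable measurable_snd
  rw [integral_map measurable_fst.aemeasurable hf.aestronglyMeasurable,
    integral_map measurable_snd.aemeasurable hh.aestronglyMeasurable, ← integral_sub hf' hh']
  refine (ofReal_integral_le_lintegral_ofReal (hf'.sub hh')).trans (lintegral_mono_ae ?_)
  filter_upwards [hle] with q hq using ENNReal.ofReal_le_ofReal hq

/-- Weak duality when the dual potentials at the atoms are real numbers. -/
lemma integral_le_of_Wdist_le {α : Type*} [MeasurableSpace α] [MeasurableSingletonClass α]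
    {d : α → α → ℝ} {p : ℝ} (hp : 0 < p)
    {N : ℕ} (hN : 0 < N) (a : Fin N → α) {θ : ℝ} (hθ : 0 ≤ θ) {g : α → ℝ}
    {lam : ℝ} (hlam : 0 ≤ lam) {μ : Measure α} [IsProbabilityMeasure μ]
    (hball : Wdist d p μ ((N : ℝ≥0∞)⁻¹ • ∑ i, Measure.dirac (a i)) ≤ ENNReal.ofReal θ)
    (hint : Integrable g μ) (s : α → ℝ)
    (hs : ∀ i w, g w - lam * d w (a i) ^ p ≤ s (a i)) :
    ∫ w, g w ∂μ ≤ lam * θ ^ p + 1 / N * ∑ i, s (a i) := by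
  have hN' : (0 : ℝ) < N := by exact_mod_cast hN
  rcases hlam.eq_or_lt with rfl | hlam
  · have hi : ∀ i, ∫ w, g w ∂μ ≤ s (a i) := fun i => by
      have := integral_mono hint (integrable_const (s (a i)))
        (fun w => by simpa using hs i w)
      simpa using this
    have hsum := Finset.sum_le_sum fun i (_ : i ∈ Finset.univ) => hi i
    simp only [Finset.sum_const, Finset.card_univ, Fintype.card_fin, nsmul_eq_mul] at hsum
    rw [zero_mul, zero_add, one_div, inv_mul_eq_div, le_div_iff₀ hN']
    linarith
  set ν : Measure α := (N : ℝ≥0∞)⁻¹ • ∑ i, Measure.dirac (a i) with hν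
  have hN_inv : (N : ℝ≥0∞)⁻¹ ≠ ⊤ := by simp [hN.ne']
  have h_int : ∀ i ∈ Finset.univ, Integrable s (Measure.dirac (a i)) := fun i _ =>
    integrable_dirac (by simp)
  have hν_int : Integrable s ν :=
    (integrable_finsetSum_measure.2 h_int).smul_measure hN_inv
  have h_val : ∫ y, s y ∂ν = 1 / N * ∑ i, s (a i) := by
    rw [hν, integral_smul_measure, integral_finsetSum_measure h_int]
    simp
  have hν_ae : ∀ᵐ y ∂ν, y ∈ Set.range a := by
    rw [ae_iff, hν]
    simp
  have key : ENNReal.ofReal ((∫ w, g w ∂μ - ∫ y, s y ∂ν) / lam) ^ (1 / p)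
      ≤ Wdist d p μ ν := by
    refine le_iInf₂ fun κ hκ => ?_
    obtain ⟨-, hfst, hsnd⟩ := hκ
    refine ENNReal.rpow_le_rpow ?_ (by positivity)
    have := ofReal_integral_sub_le_lintegral_of_coupling (κ := κ) (f := fun w => g w / lam)
      (h := fun y => s y / lam) (c := fun q => d q.1 q.2 ^ p)
      (by rw [hfst]; exact hint.div_const _) (by rw [hsnd]; exact hν_int.div_const _) ?_
    · rwa [hfst, hsnd, integral_div, integral_div, ← sub_div] at this
    · rw [← hsnd] at hν_ae
      filter_upwards [ae_of_ae_map measurable_snd.aemeasurable hν_ae] with q hq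
      obtain ⟨i, hi⟩ := hq
      have := hs i q.1
      rw [← sub_div, div_le_iff₀ hlam, ← hi]
      linarith
  have hle := key.trans hball
  rw [one_div, ENNReal.rpow_inv_le_iff hp, ENNReal.ofReal_rpow_of_nonneg hθ hp.le,
    ENNReal.ofReal_le_ofReal_iff (by positivity), div_le_iff₀ hlam, h_val] at hle
  linarith

/-- weak Kantorovich duality for the Wasserstein ball: for any
Borel-measurable `g : W → ℝ`, any `λ ≥ 0` and any Borel probability measure `μ` on `W`
with `W_p(μ, ν_N) ≤ θ` and `∫ |g| dμ < ∞`,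
`∫ g dμ ≤ λ θ^p + (1/N) ∑ᵢ sup_w [ g(w) − λ d(w, ŵ⁽ⁱ⁾)^p ]` in the extended reals. -/
theorem wasserstein_weak_duality
    {l : ℕ} (W : Set (Fin l → ℝ)) (hW : MeasurableSet W)
    (d : ↥W → ↥W → ℝ)
    (hd_nonneg : ∀ w w', 0 ≤ d w w')
    (hd_eq_zero : ∀ w w', d w w' = 0 ↔ w = w')
    (hd_symm : ∀ w w', d w w' = d w' w)
    (hd_triangle : ∀ w w' w'', d w w'' ≤ d w w' + d w' w'')
    (p : ℝ) (hp : 1 ≤ p)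
    (N : ℕ) (hN : 0 < N) (what : Fin N → ↥W)
    (ν : Measure ↥W) (hν : ν = ((N : ℝ≥0∞))⁻¹ • ∑ i, Measure.dirac (what i))
    (θ : ℝ) (hθ : 0 < θ)
    (g : ↥W → ℝ) (hg : Measurable g)
    (lam : ℝ) (hlam : 0 ≤ lam)
    (μ : Measure ↥W) (hμ : IsProbabilityMeasure μ)
    (hball : Wdist d p μ ν ≤ ENNReal.ofReal θ)
    (hint : Integrable g μ) :
    ((∫ w, g w ∂μ : ℝ) : EReal)
      ≤ ((lam * θ ^ p : ℝ) : EReal)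
        + ((1 / N : ℝ) : EReal)
          * ∑ i, ⨆ w : ↥W, ((g w - lam * d w (what i) ^ p : ℝ) : EReal) := by
  have hN' : (0 : ℝ) < 1 / N := by positivity
  have hbot : ∀ i, (⨆ w : ↥W, ((g w - lam * d w (what i) ^ p : ℝ) : EReal)) ≠ ⊥ := fun i h =>
    EReal.coe_ne_bot _ (le_bot_iff.1 (h ▸ le_iSup
      (fun w : ↥W => ((g w - lam * d w (what i) ^ p : ℝ) : EReal)) (what i)))
  by_cases htop : ∃ i, (⨆ w : ↥W, ((g w - lam * d w (what i) ^ p : ℝ) : EReal)) = ⊤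
  · obtain ⟨i, hi⟩ := htop
    have hsum : ∑ i, ⨆ w : ↥W, ((g w - lam * d w (what i) ^ p : ℝ) : EReal) = ⊤ := by
      rw [← Finset.add_sum_erase _ _ (Finset.mem_univ i), hi]
      refine EReal.top_add_of_ne_bot ?_
      refine Finset.sum_induction _ (· ≠ ⊥) (fun x y hx hy => ?_) (by simp) fun j _ => hbot j
      simp [EReal.add_eq_bot_iff, hx, hy]
    rw [hsum, EReal.coe_mul_top_of_pos hN', EReal.coe_add_top]
    exact le_top
  · push Not at htop
    set S : ↥W → EReal := fun y => ⨆ w : ↥W, ((g w - lam * d w y ^ p : ℝ) : EReal) with hS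
    have hcoe : ∀ i, ((S (what i)).toReal : EReal) = S (what i) := fun i =>
      EReal.coe_toReal (htop i) (hbot i)
    subst hν
    have hmain := integral_le_of_Wdist_le (by linarith) hN what hθ.le hlam hball hint
      (fun y => (S y).toReal) fun i w => by
        rw [← EReal.coe_le_coe_iff, hcoe i]
        exact le_iSup (fun w : ↥W => ((g w - lam * d w (what i) ^ p : ℝ) : EReal)) w
    have hsum : ∑ i, S (what i) = ((∑ i, (S (what i)).toReal : ℝ) : EReal) := by
      rw [← Finset.sum_congr rfl fun i _ => hcoe i]
      exact Finset.sum_hom_rel (r := fun x y => x = ((y : ℝ) : EReal)) rfl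
        fun i x y hxy => by rw [hxy, EReal.coe_add]
    change _ ≤ _ + _ * ∑ i, S (what i)
    rw [hsum]
    exact_mod_cast hmain
end

section
/- Let W be a closed subset of ℝ^l equipped with a continuous metric d, p ∈ [1,∞), ŵ^(1),…,ŵ^(N) ∈ W, ν_N := (1/N) Σ_{i=1}^N δ_{ŵ^(i)}, and λ ≥ 0. Let g : W → ℝ be upper semicontinuous with ∫_W |g| dν_N < ∞ and sup_{w' ∈ W} [ g(w') − λ d(ŵ^(i), w')^p ] < ∞ for every i. Then sup over all Borel probability measures μ on W of [ ∫_W g dμ − λ W_p(μ, ν_N)^p ] equals (1/N) Σ_{i=1}^N sup_{w' ∈ W} [ g(w') − λ d(ŵ^(i), w')^p ]. (Applied with g(w') := α v(f(x,u,w')) and adding the constant c(x,u), this yields the reformulation of the Wasserstein-penalty Bellman operator T'_λ.) -/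
open MeasureTheory ENNReal

/-- The uniform probability measure on a finite family of points. -/
noncomputable def empiricalMeasure {α : Type*} [MeasurableSpace α] {N : ℕ} (x : Fin N → α) :
    Measure α :=
  ((N : ℝ≥0∞))⁻¹ • ∑ i, Measure.dirac (x i)

section empiricalMeasure

variable {α β : Type*} [MeasurableSpace α] [MeasurableSpace β] {N : ℕ}

theorem isProbabilityMeasure_empiricalMeasure (hN : 0 < N) (x : Fin N → α) :
    IsProbabilityMeasure (empiricalMeasure x) := by
  refine ⟨?_⟩
  have hN' : (N : ℝ≥0∞) ≠ 0 := by exact_mod_cast hN.ne'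
  simp [empiricalMeasure, Measure.smul_apply, Measure.finsetSum_apply,
    ENNReal.inv_mul_cancel hN' (ENNReal.natCast_ne_top N)]

theorem map_empiricalMeasure {f : α → β} (hf : Measurable f) (x : Fin N → α) :
    (empiricalMeasure x).map f = empiricalMeasure fun i => f (x i) := by
  simp only [empiricalMeasure, Measure.map_smul, Measure.map_finset_sum' hf.aemeasurable,
    Measure.map_dirac' hf]

theorem lintegral_empiricalMeasure [MeasurableSingletonClass α] (x : Fin N → α)
    (f : α → ℝ≥0∞) :
    ∫⁻ a, f a ∂empiricalMeasure x = (N : ℝ≥0∞)⁻¹ * ∑ i, f (x i) := by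
  simp [empiricalMeasure, lintegral_smul_measure, lintegral_finsetSum_measure]

theorem integrable_empiricalMeasure [MeasurableSingletonClass α] (hN : 0 < N) (x : Fin N → α)
    (f : α → ℝ) : Integrable f (empiricalMeasure x) := by
  have hN' : (N : ℝ≥0∞) ≠ 0 := by exact_mod_cast hN.ne'
  refine Integrable.smul_measure ?_ (ENNReal.inv_ne_top.2 hN')
  exact integrable_finsetSum_measure.2 fun i _ => integrable_dirac (by simp)

theorem integral_empiricalMeasure [MeasurableSingletonClass α] (x : Fin N → α) (f : α → ℝ) :
    ∫ a, f a ∂empiricalMeasure x = 1 / N * ∑ i, f (x i) := by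
  rw [empiricalMeasure, integral_smul_measure, integral_finsetSum_measure
    fun i _ => integrable_dirac (by simp)]
  simp

theorem ae_empiricalMeasure [MeasurableSingletonClass α] (x : Fin N → α) {P : α → Prop}
    (h : ∀ i, P (x i)) : ∀ᵐ a ∂empiricalMeasure x, P a := by
  refine Measure.ae_smul_measure ?_ _
  rw [← Measure.sum_fintype, Measure.ae_sum_iff]
  intro i
  simp [ae_dirac_eq, h i]

end empiricalMeasure

section Wdist

variable {α : Type*} [MeasurableSpace α] {d : α → α → ℝ} {p : ℝ}

theorem Wdist_rpow_le (hp : 0 < p) {κ : Measure (α × α)} [IsProbabilityMeasure κ] :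
    Wdist d p (κ.map Prod.fst) (κ.map Prod.snd) ^ p ≤
      ∫⁻ q, ENNReal.ofReal (d q.1 q.2 ^ p) ∂κ := by
  have h : Wdist d p (κ.map Prod.fst) (κ.map Prod.snd) ≤
      (∫⁻ q, ENNReal.ofReal (d q.1 q.2 ^ p) ∂κ) ^ (1 / p) :=
    iInf₂_le κ ⟨inferInstance, rfl, rfl⟩
  refine (ENNReal.rpow_le_rpow h hp.le).trans_eq ?_
  rw [← ENNReal.rpow_mul, one_div_mul_cancel hp.ne', ENNReal.rpow_one]

theorem le_Wdist_rpow (hp : 0 < p) {μ ν : Measure α} {t : ℝ≥0∞}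
    (h : ∀ κ : Measure (α × α), IsProbabilityMeasure κ → κ.map Prod.fst = μ →
      κ.map Prod.snd = ν → t ≤ ∫⁻ q, ENNReal.ofReal (d q.1 q.2 ^ p) ∂κ) :
    t ≤ Wdist d p μ ν ^ p := by
  have h' : t ^ (1 / p) ≤ Wdist d p μ ν := le_iInf₂ fun κ hκ =>
    ENNReal.rpow_le_rpow (h κ hκ.1 hκ.2.1 hκ.2.2) (by positivity)
  refine Eq.trans_le ?_ (ENNReal.rpow_le_rpow h' hp.le)
  rw [← ENNReal.rpow_mul, one_div_mul_cancel hp.ne', ENNReal.rpow_one]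

end Wdist

/-- Weak duality along a coupling: integrating `g x ≤ h y + c (x, y)` bounds the difference of
the integrals of `g` and `h` by the transport cost. -/
theorem integral_sub_integral_le_of_coupling {α : Type*} [MeasurableSpace α]
    {κ : Measure (α × α)} {g h : α → ℝ} {c : α × α → ℝ}
    (hg : Integrable g (κ.map Prod.fst)) (hh : Integrable h (κ.map Prod.snd))
    (hc : Integrable c κ) (hle : ∀ᵐ q ∂κ, g q.1 ≤ h q.2 + c q) :
    ∫ x, g x ∂κ.map Prod.fst - ∫ y, h y ∂κ.map Prod.snd ≤ ∫ q, c q ∂κ := by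
  rw [integral_map measurable_fst.aemeasurable hg.aestronglyMeasurable,
    integral_map measurable_snd.aemeasurable hh.aestronglyMeasurable, sub_le_iff_le_add',
    ← integral_add (f := fun q => h q.2) (hh.comp_measurable measurable_snd) hc]
  exact integral_mono_ae (hg.comp_measurable measurable_fst)
    ((hh.comp_measurable measurable_snd).add hc) hle

theorem EReal.coe_ciSup {ι : Type*} [Nonempty ι] {f : ι → ℝ} (hf : BddAbove (Set.range f)) :
    ((⨆ i, f i : ℝ) : EReal) = ⨆ i, (f i : EReal) := by
  refine le_antisymm ?_ (iSup_le fun i => EReal.coe_le_coe_iff.2 (le_ciSup hf i))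
  refine EReal.ge_of_forall_gt_iff_ge.1 fun z hz => ?_
  obtain ⟨i, hi⟩ := exists_lt_of_lt_ciSup (EReal.coe_lt_coe_iff.1 hz)
  exact le_iSup_of_le i (EReal.coe_le_coe_iff.2 hi.le)

theorem EReal.coe_sub_mul_le {a b lam : ℝ} {t : ℝ≥0∞} (ht : t ≠ ⊤)
    (hab : a - lam * t.toReal ≤ b) :
    (a : EReal) - (lam : EReal) * (t : EReal) ≤ b := by
  lift t to NNReal using ht
  rw [EReal.coe_nnreal_eq_coe_real]
  exact_mod_cast hab

theorem EReal.le_coe_sub_mul {a b s lam : ℝ} {t : ℝ≥0∞} (hlam : 0 ≤ lam) (hs : 0 ≤ s)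
    (ht : t ≤ ENNReal.ofReal s) (hab : b ≤ a - lam * s) :
    (b : EReal) ≤ (a : EReal) - (lam : EReal) * (t : EReal) := by
  lift t to NNReal using (ht.trans_lt ENNReal.ofReal_lt_top).ne
  have hts : (t : ℝ) ≤ s := by
    simpa using ENNReal.toReal_le_of_le_ofReal hs ht
  have : b ≤ a - lam * t := hab.trans (by gcongr)
  rw [EReal.coe_nnreal_eq_coe_real]
  exact_mod_cast this

theorem penalized_le_of_coupling {α : Type*} [MeasurableSpace α] [MeasurableSingletonClass α]
    {d : α → α → ℝ} (hd : Measurable fun q : α × α => d q.1 q.2) (hd_nonneg : ∀ x y, 0 ≤ d x y)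
    (hd_symm : ∀ x y, d x y = d y x)
    {p : ℝ} (hp : 0 < p) {N : ℕ} (hN : 0 < N) (x : Fin N → α) {lam : ℝ} (hlam : 0 ≤ lam)
    {g : α → ℝ} (hfin : ∀ i, BddAbove (Set.range fun y => g y - lam * d (x i) y ^ p))
    {μ : Measure α} [IsProbabilityMeasure μ] (hg : Integrable g μ) :
    ((∫ y, g y ∂μ : ℝ) : EReal)
        - (lam : EReal) * ((Wdist d p μ (empiricalMeasure x) ^ p : ℝ≥0∞) : EReal) ≤
      ((1 / N * ∑ i, ⨆ y, (g y - lam * d (x i) y ^ p) : ℝ) : EReal) := by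
  have := isProbabilityMeasure_empiricalMeasure hN x
  set h : α → ℝ := fun z => ⨆ y, (g y - lam * d z y ^ p) with h_def
  have hh : Integrable h (empiricalMeasure x) := integrable_empiricalMeasure hN x h
  have hR : ∫ z, h z ∂empiricalMeasure x =
      1 / N * ∑ i, ⨆ y, (g y - lam * d (x i) y ^ p) := integral_empiricalMeasure x h
  rw [← hR]
  have key : ∀ κ : Measure (α × α), κ.map Prod.fst = μ →
      κ.map Prod.snd = empiricalMeasure x →
      Integrable (fun q : α × α => lam * d q.1 q.2 ^ p) κ →
      ∫ y, g y ∂μ - ∫ z, h z ∂empiricalMeasure x ≤ ∫ q, lam * d q.1 q.2 ^ p ∂κ := by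
    intro κ h1 h2 hc
    have hae : ∀ᵐ q ∂κ, ∀ y, g y ≤ h q.2 + lam * d y q.2 ^ p := by
      refine ae_of_ae_map (p := fun z => ∀ y, g y ≤ h z + lam * d y z ^ p)
        measurable_snd.aemeasurable ?_
      rw [h2]
      refine ae_empiricalMeasure x fun i y => ?_
      rw [hd_symm, ← sub_le_iff_le_add]
      exact le_ciSup (hfin i) y
    subst h1
    rw [← h2] at hh ⊢
    exact integral_sub_integral_le_of_coupling hg hh hc (hae.mono fun q hq => hq q.1)
  rcases hlam.eq_or_lt with rfl | hpos
  · have := key (μ.prod (empiricalMeasure x)) (by simp) (by simp) (by simp)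
    simp only [zero_mul, integral_zero] at this
    simpa using this
  have hmeas : Measurable fun q : α × α => d q.1 q.2 ^ p := hd.pow_const p
  have hle : ENNReal.ofReal ((∫ y, g y ∂μ - ∫ z, h z ∂empiricalMeasure x) / lam) ≤
      Wdist d p μ (empiricalMeasure x) ^ p := by
    refine le_Wdist_rpow hp fun κ hκ h1 h2 => ?_
    by_cases htop : ∫⁻ q, ENNReal.ofReal (d q.1 q.2 ^ p) ∂κ = ⊤
    · simp [htop]
    have hnn : ∀ q : α × α, 0 ≤ d q.1 q.2 ^ p := fun q => Real.rpow_nonneg (hd_nonneg _ _) _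
    have hint : Integrable (fun q : α × α => d q.1 q.2 ^ p) κ :=
      (lintegral_ofReal_ne_top_iff_integrable hmeas.aestronglyMeasurable
        (Filter.Eventually.of_forall hnn)).1 htop
    rw [← ofReal_integral_eq_lintegral_ofReal hint (Filter.Eventually.of_forall hnn)]
    refine ENNReal.ofReal_le_ofReal ?_
    rw [div_le_iff₀' hpos, ← integral_const_mul]
    exact key κ h1 h2 (hint.const_mul lam)
  by_cases htop : Wdist d p μ (empiricalMeasure x) ^ p = ⊤
  · simp [htop, EReal.coe_mul_top_of_pos hpos]
  refine EReal.coe_sub_mul_le htop ?_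
  have := (ENNReal.ofReal_le_iff_le_toReal htop).1 hle
  rw [div_le_iff₀' hpos] at this
  linarith

theorem le_penalized_empiricalMeasure {α : Type*} [MeasurableSpace α]
    [MeasurableSingletonClass α] {d : α → α → ℝ} (hd_nonneg : ∀ x y, 0 ≤ d x y)
    (hd_symm : ∀ x y, d x y = d y x)
    {p : ℝ} (hp : 0 < p) {N : ℕ} (hN : 0 < N) (x y : Fin N → α) {lam : ℝ} (hlam : 0 ≤ lam)
    (g : α → ℝ) :
    ((1 / N * ∑ i, (g (y i) - lam * d (x i) (y i) ^ p) : ℝ) : EReal) ≤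
      ((∫ z, g z ∂empiricalMeasure y : ℝ) : EReal) - (lam : EReal) *
        ((Wdist d p (empiricalMeasure y) (empiricalMeasure x) ^ p : ℝ≥0∞) : EReal) := by
  have := isProbabilityMeasure_empiricalMeasure hN fun i => (y i, x i)
  have hW := Wdist_rpow_le (d := d) hp (κ := empiricalMeasure fun i => (y i, x i))
  have hnn : ∀ q : α × α, 0 ≤ d q.1 q.2 ^ p := fun q => Real.rpow_nonneg (hd_nonneg _ _) _
  rw [map_empiricalMeasure measurable_fst, map_empiricalMeasure measurable_snd,
    ← ofReal_integral_eq_lintegral_ofReal (integrable_empiricalMeasure hN _ _)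
      (Filter.Eventually.of_forall hnn)] at hW
  refine EReal.le_coe_sub_mul hlam (integral_nonneg hnn) hW (le_of_eq ?_)
  rw [integral_empiricalMeasure, integral_empiricalMeasure]
  simp only [Finset.sum_sub_distrib, ← Finset.mul_sum, hd_symm (x _)]
  ring

/-- duality for the Wasserstein-penalty problem, underlying
Proposition 5: for upper semicontinuous `g` with `∫|g| dν_N < ∞` and finite
regularized suprema, the supremum over all Borel probability measures `μ` of
`∫ g dμ − λ W_p(μ, ν_N)^p` equals `(1/N) ∑ᵢ sup_{w'} [ g(w') − λ d(ŵ⁽ⁱ⁾, w')^p ]`. -/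
theorem wasserstein_penalty_duality
    {l : ℕ} (W : Set (Fin l → ℝ)) (hWclosed : IsClosed W)
    (d : ↥W → ↥W → ℝ)
    (hd_cont : Continuous fun q : ↥W × ↥W => d q.1 q.2)
    (hd_nonneg : ∀ w w', 0 ≤ d w w')
    (hd_eq_zero : ∀ w w', d w w' = 0 ↔ w = w')
    (hd_symm : ∀ w w', d w w' = d w' w)
    (hd_triangle : ∀ w w' w'', d w w'' ≤ d w w' + d w' w'')
    (p : ℝ) (hp : 1 ≤ p)
    (N : ℕ) (hN : 0 < N) (what : Fin N → ↥W)
    (ν : Measure ↥W) (hν : ν = ((N : ℝ≥0∞))⁻¹ • ∑ i, Measure.dirac (what i))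
    (lam : ℝ) (hlam : 0 ≤ lam)
    (g : ↥W → ℝ) (husc : UpperSemicontinuous g) (hgν : Integrable g ν)
    (hfin : ∀ i, BddAbove (Set.range fun w' : ↥W => g w' - lam * d (what i) w' ^ p)) :
    (⨆ μ : {μ : Measure ↥W // IsProbabilityMeasure μ ∧ Integrable g μ},
        ((∫ w, g w ∂μ.1 : ℝ) : EReal) - ((lam : ℝ) : EReal) * ((Wdist d p μ.1 ν ^ p : ℝ≥0∞) : EReal))
      = ((1 / N : ℝ) : EReal)
          * ∑ i, ⨆ w' : ↥W, ((g w' - lam * d (what i) w' ^ p : ℝ) : EReal) := by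
  have hp0 : 0 < p := by linarith
  have : Nonempty ↥W := ⟨what ⟨0, hN⟩⟩
  have hN0 : (0 : ℝ) < N := by exact_mod_cast hN
  have hd : Measurable fun q : ↥W × ↥W => d q.1 q.2 := hd_cont.measurable
  obtain rfl : ν = empiricalMeasure what := hν
  have hRHS : ((1 / N : ℝ) : EReal)
        * ∑ i, ⨆ w' : ↥W, ((g w' - lam * d (what i) w' ^ p : ℝ) : EReal) =
      ((1 / N * ∑ i, ⨆ w' : ↥W, (g w' - lam * d (what i) w' ^ p) : ℝ) : EReal) := by
    rw [EReal.coe_mul, EReal.coe_finsetSum]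
    simp only [EReal.coe_ciSup (hfin _)]
  rw [hRHS]
  refine le_antisymm (iSup_le fun ⟨μ, hμ, hgμ⟩ =>
    penalized_le_of_coupling hd hd_nonneg hd_symm hp0 hN what hlam hfin hgμ) ?_
  refine EReal.ge_of_forall_gt_iff_ge.1 fun z hz => ?_
  rw [EReal.coe_lt_coe_iff] at hz
  set S : Fin N → ℝ := fun i => ⨆ w' : ↥W, (g w' - lam * d (what i) w' ^ p)
  set ε : ℝ := 1 / N * ∑ i, S i - z with hε
  have hε0 : 0 < ε := sub_pos.2 hz
  have hex : ∀ i, ∃ w' : ↥W, S i - ε < g w' - lam * d (what i) w' ^ p := fun i =>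
    exists_lt_of_lt_ciSup (sub_lt_self (S i) hε0)
  choose y hy using hex
  refine le_iSup_of_le ⟨empiricalMeasure y, isProbabilityMeasure_empiricalMeasure hN y,
    integrable_empiricalMeasure hN y g⟩ ((EReal.coe_le_coe_iff.2 ?_).trans
      (le_penalized_empiricalMeasure hd_nonneg hd_symm hp0 hN what y hlam g))
  calc z = 1 / N * ∑ i, (S i - ε) := by
        rw [Finset.sum_sub_distrib, mul_sub, Finset.sum_const, Finset.card_univ, Fintype.card_fin,
          nsmul_eq_mul, ← mul_assoc, one_div_mul_cancel hN0.ne', one_mul, hε]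
        ring
    _ ≤ _ := by
        exact mul_le_mul_of_nonneg_left (Finset.sum_le_sum fun i _ => (hy i).le) (by positivity)
end

section
/- Let W be a closed subset of ℝ^l equipped with a continuous metric d, p ∈ [1,∞), ŵ^(1),…,ŵ^(N) ∈ W, ν_N := (1/N) Σ_{i=1}^N δ_{ŵ^(i)}, and θ > 0. Fix x and a Borel-measurable policy π with π(x) ∈ U(x), and let v be such that the map w ↦ v(f(x,π(x),w)) is upper semicontinuous, ν_N-integrable, and satisfies sup_{w∈W}[α v(f(x,π(x),w)) − λ₀ d(w,ŵ^(i))^p] < ∞ for some λ₀ ≥ 0 and all i. Then (T^π v)(x) = sup over all (w̲^(1),…,w̲^(N), w̄^(1),…,w̄^(N)) ∈ W^{2N} and q = (q_1,q_2) with q_1,q_2 ≥ 0, q_1+q_2 = 1, satisfying the constraint (1/N) Σ_{i=1}^N [ q_1 d(w̲^(i), ŵ^(i))^p + q_2 d(w̄^(i), ŵ^(i))^p ] ≤ θ^p, of the quantity c(x,π(x)) + (α/N) Σ_{i=1}^N [ q_1 v(f(x,π(x), w̲^(i))) + q_2 v(f(x,π(x), w̄^(i))) ]. -/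
open MeasureTheory ENNReal

/-- Strong duality for a finite-valued program over two-point mixtures with one budget
constraint that is strictly feasible: a bound on all feasible mixtures is witnessed by a
Lagrange multiplier. -/
theorem exists_multiplier_of_two_point_bound {ι : Type*} (D G : ι → ℝ) (B V : ℝ) (i₀ : ι)
    (hi₀ : D i₀ < B)
    (h : ∀ i j q1 q2, 0 ≤ q1 → 0 ≤ q2 → q1 + q2 = 1 → q1 * D i + q2 * D j ≤ B →
      q1 * G i + q2 * G j ≤ V) :
    ∃ r : ℝ, 0 ≤ r ∧ ∀ i, G i ≤ V + r * (D i - B) := by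
  have hle : ∀ i, D i ≤ B → G i ≤ V := fun i hi => by
    simpa using h i i 1 0 zero_le_one le_rfl (by norm_num) (by simpa using hi)
  have hcross : ∀ i j, D i < B → B < D j → (G j - V) / (D j - B) ≤ (V - G i) / (B - D i) := by
    intro i j hi hj
    have hij : 0 < D j - D i := by linarith
    have key := h i j ((D j - B) / (D j - D i)) ((B - D i) / (D j - D i))
      (div_nonneg (by linarith) hij.le) (div_nonneg (by linarith) hij.le)
      (by field_simp; ring) (le_of_eq (by field_simp; ring))
    rw [div_mul_eq_mul_div, div_mul_eq_mul_div, ← add_div, div_le_iff₀ hij] at key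
    rw [div_le_div_iff₀ (by linarith) (by linarith)]
    linarith
  set S : Set ℝ := insert 0 {s | ∃ j, B < D j ∧ s = (G j - V) / (D j - B)} with hS
  have hub : ∀ i, D i < B → ∀ s ∈ S, s ≤ (V - G i) / (B - D i) := by
    rintro i hi s (rfl | ⟨j, hj, rfl⟩)
    · exact div_nonneg (by linarith [hle i hi.le]) (by linarith)
    · exact hcross i j hi hj
  have hbdd : BddAbove S := ⟨_, hub i₀ hi₀⟩
  have h0 : (0 : ℝ) ∈ S := Set.mem_insert _ _
  refine ⟨sSup S, le_csSup hbdd h0, fun i => ?_⟩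
  rcases lt_trichotomy (D i) B with hi | hi | hi
  · have := csSup_le ⟨0, h0⟩ (hub i hi)
    rw [le_div_iff₀ (by linarith)] at this
    linarith
  · simpa [hi] using hle i hi.le
  · have := le_csSup hbdd (Set.mem_insert_of_mem 0 ⟨i, hi, rfl⟩ : (G i - V) / (D i - B) ∈ S)
    rw [div_le_iff₀ (by linarith)] at this
    linarith

/-- A uniform upper bound for a separable sum bounds the sum of the suprema. -/
theorem sum_ciSup_le_of_forall_sum_le {ι β : Type*} [Fintype ι] [Nonempty β]
    (F : ι → β → ℝ) (C : ℝ) (h : ∀ w : ι → β, ∑ i, F i (w i) ≤ C) :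
    (∀ i, BddAbove (Set.range (F i))) ∧ ∑ i, ⨆ b, F i b ≤ C := by
  classical
  have hbdd : ∀ i, BddAbove (Set.range (F i)) := by
    intro i
    let b₀ : β := Classical.arbitrary β
    refine ⟨C - ∑ j ∈ Finset.univ.erase i, F j b₀, ?_⟩
    rintro _ ⟨b, rfl⟩
    have := h (Function.update (fun _ => b₀) i b)
    rw [← Finset.add_sum_erase _ _ (Finset.mem_univ i), Function.update_self,
      Finset.sum_congr rfl (g := fun j => F j b₀)] at this
    · linarith
    · intro j hj
      rw [Function.update_of_ne (Finset.ne_of_mem_erase hj)]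
  refine ⟨hbdd, le_of_forall_pos_le_add fun ε hε => ?_⟩
  set δ := ε / (Fintype.card ι + 1) with hδ
  have hδ0 : 0 < δ := by positivity
  have hw : ∀ i, ∃ b, (⨆ b, F i b) - δ < F i b := fun i =>
    exists_lt_of_lt_ciSup (by linarith)
  choose w hw using hw
  calc ∑ i, ⨆ b, F i b ≤ ∑ i, (F i (w i) + δ) :=
        Finset.sum_le_sum fun i _ => by linarith [hw i]
    _ = ∑ i, F i (w i) + Fintype.card ι * δ := by simp [Finset.sum_add_distrib]
    _ ≤ C + ε := by
        have : (Fintype.card ι + 1) * δ = ε := by rw [hδ]; field_simp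
        linarith [h w]

/-- Weak duality for transport to an empirical measure. -/
theorem integral_le_of_coupling_empirical {Ω : Type*} [MeasurableSpace Ω]
    [MeasurableSingletonClass Ω] {N : ℕ} (hN : 0 < N) (a : Fin N → Ω)
    {κ : Measure (Ω × Ω)} {μ : Measure Ω} (hfst : κ.map Prod.fst = μ)
    (hsnd : κ.map Prod.snd = (N : ℝ≥0∞)⁻¹ • ∑ i, Measure.dirac (a i))
    {k : Ω × Ω → ℝ} (hk : Measurable k) (hk0 : ∀ z, 0 ≤ k z) {C : ℝ} (hC : 0 ≤ C)
    (hcost : ∫⁻ z, ENNReal.ofReal (k z) ∂κ ≤ ENNReal.ofReal C)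
    {g H : Ω → ℝ} (hg : Integrable g μ) {r : ℝ} (hr : 0 ≤ r)
    (hH : ∀ i w, g w - r * k (w, a i) ≤ H (a i)) :
    ∫ w, g w ∂μ ≤ r * C + (N : ℝ)⁻¹ * ∑ i, H (a i) := by
  subst hfst
  have hNtop : (N : ℝ≥0∞)⁻¹ ≠ ∞ := by simp [hN.ne']
  have hgκ : Integrable (fun z : Ω × Ω => g z.1) κ := hg.comp_measurable measurable_fst
  have hdirac : ∀ i ∈ Finset.univ, Integrable H (Measure.dirac (a i)) := fun i _ =>
    integrable_dirac (by simp)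
  have hHν : Integrable H (κ.map Prod.snd) := by
    rw [hsnd]
    exact (integrable_finsetSum_measure.2 hdirac).smul_measure hNtop
  have hHκ : Integrable (fun z : Ω × Ω => H z.2) κ := hHν.comp_measurable measurable_snd
  have hkκ : Integrable k κ := by
    refine ⟨hk.aestronglyMeasurable, ?_⟩
    rw [hasFiniteIntegral_iff_ofReal (Filter.Eventually.of_forall hk0)]
    exact hcost.trans_lt ENNReal.ofReal_lt_top
  have hkC : ∫ z, k z ∂κ ≤ C := by
    rw [integral_eq_lintegral_of_nonneg_ae (Filter.Eventually.of_forall hk0)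
      hk.aestronglyMeasurable]
    exact ENNReal.toReal_le_of_le_ofReal hC hcost
  have hsupp : ∀ᵐ z ∂κ, z.2 ∈ Set.range a := by
    have hmeas : MeasurableSet (Set.range a) := (Set.finite_range a).measurableSet
    have : ∀ᵐ w ∂(κ.map Prod.snd), w ∈ Set.range a := by
      rw [hsnd]
      refine Measure.ae_smul_measure ?_ _
      rw [ae_iff, Measure.finsetSum_apply]
      refine Finset.sum_eq_zero fun i _ => ?_
      rw [← ae_iff, ae_dirac_eq]
      exact Filter.eventually_pure.2 ⟨i, rfl⟩
    exact ae_of_ae_map measurable_snd.aemeasurable this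
  have hle : ∫ z : Ω × Ω, g z.1 ∂κ ≤ ∫ z : Ω × Ω, (r * k z + H z.2) ∂κ := by
    refine integral_mono_ae hgκ ((hkκ.const_mul r).add hHκ) ?_
    filter_upwards [hsupp] with z ⟨i, hi⟩
    have := hH i z.1
    rw [hi] at this
    change g z.1 ≤ r * k z + H z.2
    linarith
  have hHint : ∫ z : Ω × Ω, H z.2 ∂κ = (N : ℝ)⁻¹ * ∑ i, H (a i) := by
    rw [← integral_map measurable_snd.aemeasurable hHν.aestronglyMeasurable, hsnd,
      integral_smul_measure, integral_finsetSum_measure hdirac]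
    simp
  rw [integral_map measurable_fst.aemeasurable hg.aestronglyMeasurable]
  rw [integral_add (hkκ.const_mul r) hHκ, integral_const_mul, hHint] at hle
  linarith [mul_le_mul_of_nonneg_left hkC hr]

/-- The uniform average of the two-point mixtures `q1 δ_{y i} + q2 δ_{z i}`. -/
noncomputable def twoPointMixture {Ω : Type*} [MeasurableSpace Ω] {N : ℕ} (q1 q2 : ℝ)
    (y z : Fin N → Ω) : Measure Ω :=
  (N : ℝ≥0∞)⁻¹ • ∑ i, (ENNReal.ofReal q1 • Measure.dirac (y i) +
    ENNReal.ofReal q2 • Measure.dirac (z i))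

section TwoPointMixture

variable {Ω Ω' : Type*} [MeasurableSpace Ω] [MeasurableSpace Ω'] {N : ℕ} {q1 q2 : ℝ}
  (y z : Fin N → Ω)

theorem isProbabilityMeasure_twoPointMixture (hN : 0 < N) (h1 : 0 ≤ q1) (h2 : 0 ≤ q2)
    (h : q1 + q2 = 1) : IsProbabilityMeasure (twoPointMixture q1 q2 y z) := by
  refine ⟨?_⟩
  have : ENNReal.ofReal q1 + ENNReal.ofReal q2 = 1 := by
    rw [← ENNReal.ofReal_add h1 h2, h, ENNReal.ofReal_one]
  simp [twoPointMixture, Measure.finsetSum_apply, this,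
    ENNReal.inv_mul_cancel (Nat.cast_ne_zero.2 hN.ne') (ENNReal.natCast_ne_top N)]

theorem map_twoPointMixture {φ : Ω → Ω'} (hφ : Measurable φ) :
    (twoPointMixture q1 q2 y z).map φ = twoPointMixture q1 q2 (φ ∘ y) (φ ∘ z) := by
  ext s hs
  simp [twoPointMixture, Measure.map_apply hφ hs, Measure.finsetSum_apply, hs, hφ hs,
    Set.indicator]
  rfl

theorem twoPointMixture_self (h1 : 0 ≤ q1) (h2 : 0 ≤ q2) (h : q1 + q2 = 1) :
    twoPointMixture q1 q2 y y = (N : ℝ≥0∞)⁻¹ • ∑ i, Measure.dirac (y i) := by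
  simp only [twoPointMixture, ← add_smul, ← ENNReal.ofReal_add h1 h2, h, ENNReal.ofReal_one,
    one_smul]

variable [MeasurableSingletonClass Ω] (g : Ω → ℝ)

theorem integrable_twoPointMixture (hN : 0 < N) :
    Integrable g (twoPointMixture q1 q2 y z) := by
  refine (integrable_finsetSum_measure.2 fun i _ => ?_).smul_measure (by simp [hN.ne'])
  exact ((integrable_dirac (by simp)).smul_measure ENNReal.ofReal_ne_top).add_measure
    ((integrable_dirac (by simp)).smul_measure ENNReal.ofReal_ne_top)

theorem integral_twoPointMixture (h1 : 0 ≤ q1) (h2 : 0 ≤ q2) :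
    ∫ w, g w ∂(twoPointMixture q1 q2 y z)
      = (N : ℝ)⁻¹ * ∑ i, (q1 * g (y i) + q2 * g (z i)) := by
  have hd : ∀ (q : ℝ) (b : Ω), Integrable g (ENNReal.ofReal q • Measure.dirac b) := fun q b =>
    (integrable_dirac (by simp)).smul_measure ENNReal.ofReal_ne_top
  rw [twoPointMixture, integral_smul_measure,
    integral_finsetSum_measure fun i _ => (hd _ _).add_measure (hd _ _)]
  simp only [integral_add_measure (hd _ _) (hd _ _), integral_smul_measure, integral_dirac,
    ENNReal.toReal_ofReal h1, ENNReal.toReal_ofReal h2, smul_eq_mul, ENNReal.toReal_inv,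
    ENNReal.toReal_natCast]

end TwoPointMixture

/-- Proposition 3: finite reformulation of the policy Bellman
operator: `(T^π v)(x)`, the worst-case expected cost-to-go over the Wasserstein ball,
equals the optimal value of a finite-dimensional program over `2N` support points and a
two-point probability vector `q` subject to a transport budget constraint. -/
theorem policy_bellman_finite_reformulation
    {n m l : ℕ} (Xs : Set (Fin n → ℝ)) (Us : Set (Fin m → ℝ)) (W : Set (Fin l → ℝ))
    (hWclosed : IsClosed W)
    (d : ↥W → ↥W → ℝ)
    (hd_cont : Continuous fun q : ↥W × ↥W => d q.1 q.2)
    (hd_nonneg : ∀ w w', 0 ≤ d w w')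
    (hd_eq_zero : ∀ w w', d w w' = 0 ↔ w = w')
    (hd_symm : ∀ w w', d w w' = d w' w)
    (hd_triangle : ∀ w w' w'', d w w'' ≤ d w w' + d w' w'')
    (p : ℝ) (hp : 1 ≤ p)
    (N : ℕ) (hN : 0 < N) (what : Fin N → ↥W)
    (ν : Measure ↥W) (hν : ν = ((N : ℝ≥0∞))⁻¹ • ∑ i, Measure.dirac (what i))
    (θ : ℝ) (hθ : 0 < θ)
    (f : ↥Xs → ↥Us → ↥W → ↥Xs) (c : ↥Xs → ↥Us → ℝ)
    (α : ℝ) (hα0 : 0 < α) (hα1 : α < 1)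
    (Uadm : ↥Xs → Set ↥Us)
    (π : ↥Xs → ↥Us) (hπm : Measurable π) (hπadm : ∀ y, π y ∈ Uadm y)
    (v : ↥Xs → ℝ) (x : ↥Xs)
    (husc : UpperSemicontinuous fun w : ↥W => v (f x (π x) w))
    (hint : Integrable (fun w => v (f x (π x) w)) ν)
    (lam0 : ℝ) (hlam0 : 0 ≤ lam0)
    (hfin : ∀ i, BddAbove
      (Set.range fun w : ↥W => α * v (f x (π x) w) - lam0 * d w (what i) ^ p)) :
    (⨆ μ : {μ : Measure ↥W // IsProbabilityMeasure μ ∧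
          Integrable (fun w => v (f x (π x) w)) μ ∧ Wdist d p μ ν ≤ ENNReal.ofReal θ},
        ((c x (π x) + α * ∫ w, v (f x (π x) w) ∂μ.1 : ℝ) : EReal))
      = ⨆ (wl : Fin N → ↥W) (wu : Fin N → ↥W) (q1 : ℝ) (q2 : ℝ)
          (_ : 0 ≤ q1 ∧ 0 ≤ q2 ∧ q1 + q2 = 1 ∧
            (1 / N : ℝ) * ∑ i, (q1 * d (wl i) (what i) ^ p + q2 * d (wu i) (what i) ^ p)
              ≤ θ ^ p),
          ((c x (π x)
              + (α / N : ℝ) * ∑ i, (q1 * v (f x (π x) (wl i)) + q2 * v (f x (π x) (wu i)))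
            : ℝ) : EReal) := by
  have hp0 : 0 < p := by linarith
  have hN0 : (0 : ℝ) < N := Nat.cast_pos.2 hN
  have : Nonempty ↥W := ⟨what ⟨0, hN⟩⟩
  set g : ↥W → ℝ := fun w => v (f x (π x) w) with hg
  have hkm : Measurable fun z : ↥W × ↥W => d z.1 z.2 ^ p :=
    (hd_cont.rpow_const fun _ => Or.inr hp0.le).measurable
  have hk0 : ∀ z : ↥W × ↥W, 0 ≤ d z.1 z.2 ^ p := fun z => Real.rpow_nonneg (hd_nonneg _ _) _
  apply le_antisymm
  · refine EReal.le_of_forall_lt_iff_le.1 fun R hR => iSup_le ?_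
    rintro ⟨μ, hμ, hgμ, hW⟩
    rw [EReal.coe_le_coe_iff]
    have hbound : ∀ (wl wu : Fin N → ↥W) (q1 q2 : ℝ), 0 ≤ q1 → 0 ≤ q2 → q1 + q2 = 1 →
        q1 * ((N : ℝ)⁻¹ * ∑ i, d (wl i) (what i) ^ p)
          + q2 * ((N : ℝ)⁻¹ * ∑ i, d (wu i) (what i) ^ p) ≤ θ ^ p →
        q1 * ((N : ℝ)⁻¹ * ∑ i, g (wl i)) + q2 * ((N : ℝ)⁻¹ * ∑ i, g (wu i))
          ≤ (R - c x (π x)) / α := by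
      intro wl wu q1 q2 h1 h2 h12 hb
      have hfeas : 0 ≤ q1 ∧ 0 ≤ q2 ∧ q1 + q2 = 1 ∧
          (1 / N : ℝ) * ∑ i, (q1 * d (wl i) (what i) ^ p + q2 * d (wu i) (what i) ^ p)
            ≤ θ ^ p := by
        refine ⟨h1, h2, h12, le_of_eq_of_le ?_ hb⟩
        rw [Finset.sum_add_distrib, ← Finset.mul_sum, ← Finset.mul_sum]
        ring
      have hval := hR.le
      simp only [iSup_le_iff] at hval
      replace hval := hval wl wu q1 q2 hfeas
      rw [EReal.coe_le_coe_iff, Finset.sum_add_distrib, ← Finset.mul_sum, ← Finset.mul_sum]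
        at hval
      rw [le_div_iff₀ hα0]
      refine le_trans (le_of_eq ?_) (le_sub_iff_add_le'.2 hval)
      ring
    obtain ⟨r, hr, hlag⟩ := exists_multiplier_of_two_point_bound
      (fun w : Fin N → ↥W => (N : ℝ)⁻¹ * ∑ i, d (w i) (what i) ^ p)
      (fun w => (N : ℝ)⁻¹ * ∑ i, g (w i)) (θ ^ p) ((R - c x (π x)) / α) what
      (by simpa [(hd_eq_zero _ _).2, Real.zero_rpow hp0.ne'] using Real.rpow_pos_of_pos hθ p)
      hbound
    set V := (R - c x (π x)) / α with hV
    obtain ⟨hbdd, hsum⟩ := sum_ciSup_le_of_forall_sum_le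
      (fun (i : Fin N) w => g w - r * d w (what i) ^ p) (N * (V - r * θ ^ p)) (by
        intro w
        have hw := mul_le_mul_of_nonneg_left (hlag w) hN0.le
        rw [Finset.sum_sub_distrib, ← Finset.mul_sum]
        field_simp at hw
        linarith)
    have hε : ∀ t, θ < t → ∫ w, g w ∂μ ≤ V + r * (t ^ p - θ ^ p) := by
      intro t ht
      have ht0 : 0 < t := hθ.trans ht
      have hlt : Wdist d p μ ν < ENNReal.ofReal t :=
        hW.trans_lt ((ENNReal.ofReal_lt_ofReal_iff ht0).2 ht)
      simp only [Wdist, iInf_lt_iff] at hlt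
      obtain ⟨κ, ⟨-, hfst, hsnd⟩, hκ⟩ := hlt
      have hcost : ∫⁻ z, ENNReal.ofReal (d z.1 z.2 ^ p) ∂κ ≤ ENNReal.ofReal (t ^ p) := by
        rw [← ENNReal.ofReal_rpow_of_pos ht0]
        rw [one_div] at hκ
        exact (ENNReal.rpow_inv_le_iff hp0).1 hκ.le
      have := integral_le_of_coupling_empirical hN what hfst (hsnd.trans hν) hkm hk0
        (Real.rpow_nonneg ht0.le p) hcost hgμ hr
        (H := fun w' => ⨆ w, g w - r * d w w' ^ p) fun i w => le_ciSup (hbdd i) w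
      have hs := mul_le_mul_of_nonneg_left hsum (inv_nonneg.2 hN0.le)
      rw [inv_mul_cancel_left₀ hN0.ne'] at hs
      linarith
    have hlim : ∫ w, g w ∂μ ≤ V := by
      have hcont : Filter.Tendsto (fun t : ℝ => V + r * (t ^ p - θ ^ p))
          (nhdsWithin θ (Set.Ioi θ)) (nhds (V + r * (θ ^ p - θ ^ p))) := by
        have : Continuous fun t : ℝ => V + r * (t ^ p - θ ^ p) :=
          continuous_const.add (continuous_const.mul
            ((Real.continuous_rpow_const hp0.le).sub continuous_const))
        exact this.continuousWithinAt.tendsto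
      rw [sub_self, mul_zero, add_zero] at hcont
      exact ge_of_tendsto hcont (eventually_nhdsWithin_of_forall hε)
    rw [hV, le_div_iff₀ hα0] at hlim
    linarith
  · refine iSup_le fun wl => iSup_le fun wu => iSup_le fun q1 => iSup_le fun q2 =>
      iSup_le ?_
    rintro ⟨h1, h2, h12, hb⟩
    have hWd : Wdist d p (twoPointMixture q1 q2 wl wu) ν ≤ ENNReal.ofReal θ := by
      set κ := twoPointMixture q1 q2 (fun i => (wl i, what i)) (fun i => (wu i, what i)) with hκ
      have hsnd : κ.map Prod.snd = ν := by
        rw [hκ, map_twoPointMixture _ _ measurable_snd, hν]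
        exact twoPointMixture_self _ h1 h2 h12
      refine (iInf₂_le κ ⟨isProbabilityMeasure_twoPointMixture _ _ hN h1 h2 h12,
        map_twoPointMixture _ _ measurable_fst, hsnd⟩).trans ?_
      rw [one_div, ENNReal.rpow_inv_le_iff hp0, ENNReal.ofReal_rpow_of_pos hθ,
        ← ofReal_integral_eq_lintegral_ofReal
          (integrable_twoPointMixture _ _ _ hN) (Filter.Eventually.of_forall hk0),
        integral_twoPointMixture _ _ _ h1 h2]
      refine ENNReal.ofReal_le_ofReal ?_
      rwa [one_div] at hb
    refine le_iSup_of_le ⟨twoPointMixture q1 q2 wl wu,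
      isProbabilityMeasure_twoPointMixture _ _ hN h1 h2 h12,
      integrable_twoPointMixture _ _ _ hN, hWd⟩ ?_
    rw [EReal.coe_le_coe_iff, integral_twoPointMixture _ _ _ h1 h2]
    refine le_of_eq ?_
    ring
end

section
/- Let P be a symmetric positive semidefinite n×n real matrix, A an n×n matrix, B an n×m matrix, Ξ an n×l matrix, α > 0, and λ > 0 such that λI − αΞᵀPΞ is positive definite. Then for every x ∈ ℝⁿ, u ∈ ℝᵐ, and w ∈ ℝˡ, the function w' ↦ α (Ax + Bu + Ξw')ᵀ P (Ax + Bu + Ξw') − λ ‖w − w'‖² on ℝˡ is strictly concave and attains its supremum at the unique maximizer w* := (λI − αΞᵀPΞ)⁻¹ [ αΞᵀP(Ax + Bu) + λ w ]. -/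
open Matrix

/-- Binomial expansion of the quadratic form of a symmetric matrix. -/
lemma Matrix.IsSymm.add_dotProduct_mulVec_add {ι R : Type*} [Fintype ι] [CommRing R]
    {M : Matrix ι ι R} (hM : M.IsSymm) (x y : ι → R) :
    (x + y) ⬝ᵥ M *ᵥ (x + y) = x ⬝ᵥ M *ᵥ x + 2 * (y ⬝ᵥ M *ᵥ x) + y ⬝ᵥ M *ᵥ y := by
  have h : x ⬝ᵥ M *ᵥ y = y ⬝ᵥ M *ᵥ x := by
    rw [dotProduct_comm, ← vecMul_transpose, hM.eq, dotProduct_mulVec]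
  rw [mulVec_add, dotProduct_add, add_dotProduct, add_dotProduct, h]
  ring

lemma Matrix.PosDef.strictConcaveOn_sub_dotProduct_mulVec {ι : Type*} [Fintype ι]
    {M : Matrix ι ι ℝ} (hM : M.PosDef) (c : ℝ) (s : ι → ℝ) :
    StrictConcaveOn ℝ Set.univ fun y => c - (y - s) ⬝ᵥ M *ᵥ (y - s) := by
  refine ⟨convex_univ, fun x _ y _ hxy a b ha hb hab => ?_⟩
  have hsymm : M.IsSymm := by simpa using hM.isHermitian
  have hpos := hM.dotProduct_mulVec_pos (sub_ne_zero.mpr hxy)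
  rw [star_trivial] at hpos
  obtain rfl : b = 1 - a := by linarith
  have hcomb : a • x + (1 - a) • y - s = (y - s) + a • (x - y) := by module
  have hx : x - s = (y - s) + (x - y) := by abel
  have hab' := mul_pos (mul_pos ha hb) hpos
  simp only [hcomb, hx, hsymm.add_dotProduct_mulVec_add, mulVec_smul, smul_dotProduct,
    dotProduct_smul, smul_eq_mul]
  linarith

/-- inner maximization in the linear-quadratic Wasserstein-penalty
problem: for `λ` such that `λI − αΞᵀPΞ` is positive definite, the map
`w' ↦ α (Ax + Bu + Ξw')ᵀ P (Ax + Bu + Ξw') − λ‖w − w'‖²` is strictly concave and attains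
its supremum at the unique maximizer
`w* = (λI − αΞᵀPΞ)⁻¹ [αΞᵀP(Ax + Bu) + λw]`. -/
theorem lq_inner_maximizer
    {n m l : ℕ}
    (P : Matrix (Fin n) (Fin n) ℝ) (hP : P.PosSemidef)
    (A : Matrix (Fin n) (Fin n) ℝ) (B : Matrix (Fin n) (Fin m) ℝ)
    (Ξ : Matrix (Fin n) (Fin l) ℝ)
    (α lam : ℝ) (hα : 0 < α) (hlam : 0 < lam)
    (hpd : (lam • (1 : Matrix (Fin l) (Fin l) ℝ) - α • (Ξᵀ * P * Ξ)).PosDef)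
    (x : Fin n → ℝ) (u : Fin m → ℝ) (w : Fin l → ℝ)
    (φ : (Fin l → ℝ) → ℝ)
    (hφ : φ = fun w' =>
      α * ((A.mulVec x + B.mulVec u + Ξ.mulVec w') ⬝ᵥ
          P.mulVec (A.mulVec x + B.mulVec u + Ξ.mulVec w'))
        - lam * ((w - w') ⬝ᵥ (w - w')))
    (wstar : Fin l → ℝ)
    (hwstar : wstar = (lam • (1 : Matrix (Fin l) (Fin l) ℝ) - α • (Ξᵀ * P * Ξ))⁻¹.mulVec
        (α • (Ξᵀ * P).mulVec (A.mulVec x + B.mulVec u) + lam • w)) :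
    StrictConcaveOn ℝ Set.univ φ
      ∧ (∀ y, φ y ≤ φ wstar)
      ∧ (∀ y, φ y = φ wstar → y = wstar) := by
  set M := lam • (1 : Matrix (Fin l) (Fin l) ℝ) - α • (Ξᵀ * P * Ξ) with hM
  set v := A *ᵥ x + B *ᵥ u
  have hPsymm : P.IsSymm := by simpa using hP.isHermitian
  have hMsymm : M.IsSymm := by simpa using hpd.isHermitian
  have hMw : M *ᵥ wstar = α • (Ξᵀ * P) *ᵥ v + lam • w := by
    rw [hwstar, mulVec_mulVec, mul_nonsing_inv _ hpd.det_pos.ne'.isUnit, one_mulVec]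
  have hΞ (y : Fin l → ℝ) (z : Fin n → ℝ) : (Ξ *ᵥ y) ⬝ᵥ z = y ⬝ᵥ Ξᵀ *ᵥ z := by
    rw [dotProduct_mulVec, vecMul_transpose]
  have hexpand (y : Fin l → ℝ) :
      φ y = α * (v ⬝ᵥ P *ᵥ v) - lam * (w ⬝ᵥ w) + 2 * (y ⬝ᵥ M *ᵥ wstar) - y ⬝ᵥ M *ᵥ y := by
    rw [hMw, hM]
    simp only [hφ, hPsymm.add_dotProduct_mulVec_add, hΞ, sub_mulVec, smul_mulVec, one_mulVec,
      dotProduct_add, dotProduct_sub, sub_dotProduct, dotProduct_smul, smul_eq_mul,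
      mulVec_mulVec, Matrix.mul_assoc, dotProduct_comm w y]
    ring
  have hsquare (y : Fin l → ℝ) : φ y = φ wstar - (y - wstar) ⬝ᵥ M *ᵥ (y - wstar) := by
    have h := hMsymm.add_dotProduct_mulVec_add wstar (y - wstar)
    rw [add_sub_cancel, sub_dotProduct y wstar (M *ᵥ wstar)] at h
    rw [hexpand y, hexpand wstar]
    linarith
  refine ⟨?_, fun y => ?_, fun y hy => ?_⟩
  · rw [funext hsquare]
    exact hpd.strictConcaveOn_sub_dotProduct_mulVec _ _
  · have h := hpd.posSemidef.dotProduct_mulVec_nonneg (y - wstar)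
    rw [star_trivial] at h
    linarith [hsquare y]
  · by_contra hne
    have h := hpd.dotProduct_mulVec_pos (sub_ne_zero.mpr hne)
    rw [star_trivial] at h
    linarith [hsquare y]
end

section
/- Consider the linear-quadratic Wasserstein-penalty setting. Let P be a symmetric positive semidefinite n×n matrix such that λI − αΞᵀPΞ is positive definite and P solves the modified Riccati equation P = Q + α AᵀPA + α² AᵀSA, where S := PΞ(λI − αΞᵀPΞ)⁻¹ΞᵀP − [I + αΞ(λI − αΞᵀPΞ)⁻¹ΞᵀP]ᵀ P B [ R + αBᵀ{P + αPΞ(λI − αΞᵀPΞ)⁻¹ΞᵀP}B ]⁻¹ BᵀP [I + αΞ(λI − αΞᵀPΞ)⁻¹ΞᵀP]. Define z := (λ/(1−α)) · tr[ ( λ(λI − αΞᵀPΞ)⁻¹ − I ) Σ ] and K := −[ R + αBᵀ{P + αPΞ(λI − αΞᵀPΞ)⁻¹ΞᵀP}B ]⁻¹ α Bᵀ Pᵀ [ I + αΞ(λI − αΞᵀPΞ)⁻¹ΞᵀP ] A. Then for every x ∈ ℝⁿ, the function u ↦ xᵀQx + uᵀRu + (1/N) Σ_{i=1}^N sup_{w'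 ∈ ℝˡ} [ α ( (Ax + Bu + Ξw')ᵀ P (Ax + Bu + Ξw') + z ) − λ ‖ŵ^(i) − w'‖² ] attains its infimum over u ∈ ℝᵐ uniquely at u = Kx, and this infimum equals xᵀPx + z; i.e., v'(x) := xᵀPx + z solves the Bellman equation of the Wasserstein-penalty linear-quadratic problem with optimal feedback policy π'(x) = Kx. -/
open Matrix MeasureTheory

section QuadraticForms

variable {ι : Type*}

lemma Matrix.PosDef.transpose_eq {H : Matrix ι ι ℝ} (hH : H.PosDef) : Hᵀ = H := by
  simpa [IsHermitian, conjTranspose_eq_transpose_of_trivial] using hH.isHermitian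

variable [Fintype ι]

/-- Symmetric real matrices define symmetric bilinear forms. -/
lemma Matrix.dotProduct_mulVec_symm_of_transpose_eq {H : Matrix ι ι ℝ} (hH : Hᵀ = H)
    (v w : ι → ℝ) : v ⬝ᵥ H *ᵥ w = w ⬝ᵥ H *ᵥ v := by
  rw [dotProduct_comm, ← vecMul_transpose, hH, ← dotProduct_mulVec]

/-- Completing the square for a positive definite quadratic form. -/
lemma Matrix.PosDef.complete_square [DecidableEq ι] {H : Matrix ι ι ℝ} (hH : H.PosDef) (w b : ι → ℝ) :
    w ⬝ᵥ H *ᵥ w + 2 * (w ⬝ᵥ b)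
      = (w + H⁻¹ *ᵥ b) ⬝ᵥ H *ᵥ (w + H⁻¹ *ᵥ b) - b ⬝ᵥ H⁻¹ *ᵥ b := by
  have hb : H *ᵥ (H⁻¹ *ᵥ b) = b := by
    rw [mulVec_mulVec, mul_nonsing_inv _ ((isUnit_iff_isUnit_det _).1 hH.isUnit), one_mulVec]
  have hs := dotProduct_mulVec_symm_of_transpose_eq hH.transpose_eq (H⁻¹ *ᵥ b) w
  rw [hb] at hs
  rw [mulVec_add, hb, add_dotProduct, dotProduct_add, dotProduct_add, hs,
    dotProduct_comm (H⁻¹ *ᵥ b) b]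
  ring

/-- The supremum of a concave quadratic function. -/
lemma Matrix.PosDef.iSup_concave_quadratic [DecidableEq ι] {H : Matrix ι ι ℝ} (hH : H.PosDef)
    (b : ι → ℝ) (c : ℝ) :
    ⨆ w : ι → ℝ, (c + 2 * (w ⬝ᵥ b) - w ⬝ᵥ H *ᵥ w) = c + b ⬝ᵥ H⁻¹ *ᵥ b := by
  have hsq (w : ι → ℝ) : c + 2 * (w ⬝ᵥ b) - w ⬝ᵥ H *ᵥ w
      = c + b ⬝ᵥ H⁻¹ *ᵥ b - (w - H⁻¹ *ᵥ b) ⬝ᵥ H *ᵥ (w - H⁻¹ *ᵥ b) := by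
    have h := hH.complete_square w (-b)
    simp only [mulVec_neg, dotProduct_neg, neg_dotProduct, ← sub_eq_add_neg] at h
    linarith
  refine IsGreatest.csSup_eq ⟨⟨H⁻¹ *ᵥ b, ?_⟩, ?_⟩
  · simp only [hsq, sub_self, zero_dotProduct, sub_zero]
  · rintro _ ⟨w, rfl⟩
    have h := hH.posSemidef.dotProduct_mulVec_nonneg (w - H⁻¹ *ᵥ b)
    simp only [star_trivial] at h
    simp only [hsq]
    linarith

/-- Averaging a quadratic form over an affine image of a centred sample splits it into its value
at the mean and a trace against the empirical second moment. -/
lemma Matrix.average_quadratic_form {N : ℕ} (hN : 0 < N) (w : Fin N → ι → ℝ)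
    (hmean : (1 / N : ℝ) • ∑ i, w i = 0) {H : Matrix ι ι ℝ} (hH : Hᵀ = H) (b : ι → ℝ) (r : ℝ) :
    (1 / N : ℝ) * ∑ i, (b + r • w i) ⬝ᵥ H *ᵥ (b + r • w i)
      = b ⬝ᵥ H *ᵥ b
        + r ^ 2 * trace (H * ((1 / N : ℝ) • ∑ i, vecMulVec (w i) (w i))) := by
  have hN' : (N : ℝ) ≠ 0 := by positivity
  have hterm (i : Fin N) : (b + r • w i) ⬝ᵥ H *ᵥ (b + r • w i)
      = b ⬝ᵥ H *ᵥ b + 2 * r * (w i ⬝ᵥ H *ᵥ b) + r ^ 2 * (w i ⬝ᵥ H *ᵥ w i) := by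
    simp only [mulVec_add, add_dotProduct, dotProduct_add, mulVec_smul, smul_dotProduct,
      dotProduct_smul, smul_eq_mul]
    rw [dotProduct_mulVec_symm_of_transpose_eq hH b (w i)]
    ring
  have hcross : ∑ i, w i ⬝ᵥ H *ᵥ b = 0 := by
    rw [← sum_dotProduct, (smul_eq_zero.1 hmean).resolve_left (by simpa using hN'),
      zero_dotProduct]
  have htrace : trace (H * ((1 / N : ℝ) • ∑ i, vecMulVec (w i) (w i)))
      = (1 / N : ℝ) * ∑ i, w i ⬝ᵥ H *ᵥ w i := by
    rw [Matrix.mul_smul, trace_smul, Matrix.mul_sum, trace_sum, smul_eq_mul]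
    simp only [mul_vecMulVec, trace_vecMulVec, dotProduct_comm]
  simp only [hterm, Finset.sum_add_distrib, ← Finset.mul_sum, hcross, htrace]
  simp only [Finset.sum_const, Finset.card_univ, Fintype.card_fin, nsmul_eq_mul]
  field_simp
  ring

end QuadraticForms

/-- Theorem 5: Riccati solution of the linear-quadratic
Wasserstein-penalty problem: if `P ⪰ 0` solves the modified Riccati equation
`P = Q + αAᵀPA + α²AᵀSA` (with `λI − αΞᵀPΞ ≻ 0`), then `v'(x) = xᵀPx + z` solves the
Bellman equation: for every `x`, the map
`u ↦ xᵀQx + uᵀRu + (1/N) ∑ᵢ sup_{w'} [α((Ax+Bu+Ξw')ᵀP(Ax+Bu+Ξw') + z) − λ‖ŵ⁽ⁱ⁾ − w'‖²]`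
attains its infimum uniquely at `u = Kx`, with value `xᵀPx + z`. -/
theorem lq_riccati_bellman
    {n m l : ℕ}
    (A : Matrix (Fin n) (Fin n) ℝ) (B : Matrix (Fin n) (Fin m) ℝ)
    (Ξ : Matrix (Fin n) (Fin l) ℝ)
    (Q : Matrix (Fin n) (Fin n) ℝ) (hQ : Q.PosSemidef)
    (R : Matrix (Fin m) (Fin m) ℝ) (hR : R.PosDef)
    (α : ℝ) (hα0 : 0 < α) (hα1 : α < 1)
    (lam : ℝ) (hlam : 0 < lam)
    (N : ℕ) (hN : 0 < N) (what : Fin N → (Fin l → ℝ))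
    (hmean : (1 / N : ℝ) • ∑ i, what i = 0)
    (Sig : Matrix (Fin l) (Fin l) ℝ)
    (hSig : Sig = (1 / N : ℝ) • ∑ i, vecMulVec (what i) (what i))
    (P : Matrix (Fin n) (Fin n) ℝ) (hP : P.PosSemidef)
    (G : Matrix (Fin l) (Fin l) ℝ)
    (hG : G = lam • (1 : Matrix (Fin l) (Fin l) ℝ) - α • (Ξᵀ * P * Ξ))
    (hGpd : G.PosDef)
    (S : Matrix (Fin n) (Fin n) ℝ)
    (hS : S = P * Ξ * G⁻¹ * Ξᵀ * P
      - ((1 : Matrix (Fin n) (Fin n) ℝ) + α • (Ξ * G⁻¹ * Ξᵀ * P))ᵀ * P * B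
          * (R + α • (Bᵀ * (P + α • (P * Ξ * G⁻¹ * Ξᵀ * P)) * B))⁻¹
          * Bᵀ * P * ((1 : Matrix (Fin n) (Fin n) ℝ) + α • (Ξ * G⁻¹ * Ξᵀ * P)))
    (hRiccati : P = Q + α • (Aᵀ * P * A) + (α ^ 2) • (Aᵀ * S * A))
    (z : ℝ)
    (hz : z = lam / (1 - α) * Matrix.trace ((lam • G⁻¹ - 1) * Sig))
    (K : Matrix (Fin m) (Fin n) ℝ)
    (hK : K = -((R + α • (Bᵀ * (P + α • (P * Ξ * G⁻¹ * Ξᵀ * P)) * B))⁻¹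
        * (α • (Bᵀ * Pᵀ * ((1 : Matrix (Fin n) (Fin n) ℝ) + α • (Ξ * G⁻¹ * Ξᵀ * P)) * A)))) :
    ∀ (x : Fin n → ℝ) (F : (Fin m → ℝ) → ℝ),
      (F = fun u => x ⬝ᵥ Q.mulVec x + u ⬝ᵥ R.mulVec u + (1 / N : ℝ) *
        ∑ i, ⨆ w' : Fin l → ℝ,
          (α * ((A.mulVec x + B.mulVec u + Ξ.mulVec w') ⬝ᵥ
              P.mulVec (A.mulVec x + B.mulVec u + Ξ.mulVec w') + z)
            - lam * ((what i - w') ⬝ᵥ (what i - w')))) →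
      (∀ u, F (K.mulVec x) ≤ F u)
        ∧ (∀ u, F u = F (K.mulVec x) → u = K.mulVec x)
        ∧ F (K.mulVec x) = x ⬝ᵥ P.mulVec x + z := by
  rintro x F hF
  have hPt : Pᵀ = P := by
    simpa [IsHermitian, conjTranspose_eq_transpose_of_trivial] using hP.isHermitian
  have hGt : G⁻¹ᵀ = G⁻¹ := hGpd.inv.transpose_eq
  set M : Matrix (Fin n) (Fin n) ℝ := P + α • (P * Ξ * G⁻¹ * Ξᵀ * P) with hM
  have hMt : Mᵀ = M := by
    simp [hM, transpose_mul, hPt, hGt, Matrix.mul_assoc]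
  have hPM : P * (1 + α • (Ξ * G⁻¹ * Ξᵀ * P)) = M := by
    simp [hM, Matrix.mul_add, Matrix.mul_assoc]
  have hMP : (1 + α • (Ξ * G⁻¹ * Ξᵀ * P))ᵀ * P = M := by
    rw [← hMt, ← hPM, transpose_mul, hPt]
  have hMquad (y : Fin n → ℝ) : y ⬝ᵥ M *ᵥ y
      = y ⬝ᵥ P *ᵥ y + α * ((Ξᵀ *ᵥ (P *ᵥ y)) ⬝ᵥ G⁻¹ *ᵥ (Ξᵀ *ᵥ (P *ᵥ y))) := by
    have h : y ⬝ᵥ (P * Ξ * G⁻¹ * Ξᵀ * P) *ᵥ y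
        = (Ξᵀ *ᵥ (P *ᵥ y)) ⬝ᵥ G⁻¹ *ᵥ (Ξᵀ *ᵥ (P *ᵥ y)) := by
      simp only [← mulVec_mulVec]
      rw [dotProduct_mulVec, dotProduct_mulVec, ← mulVec_transpose, ← mulVec_transpose, hPt]
    rw [hM, add_mulVec, smul_mulVec, dotProduct_add, dotProduct_smul, h, smul_eq_mul]
  have hMnonneg (y : Fin n → ℝ) : 0 ≤ y ⬝ᵥ M *ᵥ y := by
    have h1 := hP.dotProduct_mulVec_nonneg y
    have h2 := hGpd.inv.posSemidef.dotProduct_mulVec_nonneg (Ξᵀ *ᵥ (P *ᵥ y))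
    simp only [star_trivial] at h1 h2
    rw [hMquad]
    positivity
  have hMpsd : M.PosSemidef :=
    PosSemidef.of_dotProduct_mulVec_nonneg
      (by simpa [IsHermitian, conjTranspose_eq_transpose_of_trivial] using hMt)
      (by simpa using hMnonneg)
  set H : Matrix (Fin m) (Fin m) ℝ := R + α • (Bᵀ * M * B) with hH
  have hHpd : H.PosDef := by
    refine hR.add_posSemidef (PosSemidef.smul ?_ hα0.le)
    simpa [conjTranspose_eq_transpose_of_trivial] using hMpsd.conjTranspose_mul_mul_same B
  have hsup (y : Fin n → ℝ) (v : Fin l → ℝ) :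
      ⨆ w' : Fin l → ℝ, (α * ((y + Ξ *ᵥ w') ⬝ᵥ P *ᵥ (y + Ξ *ᵥ w') + z)
          - lam * ((v - w') ⬝ᵥ (v - w')))
        = (α * (y ⬝ᵥ P *ᵥ y + z) - lam * (v ⬝ᵥ v))
          + (α • (Ξᵀ *ᵥ (P *ᵥ y)) + lam • v) ⬝ᵥ G⁻¹ *ᵥ (α • (Ξᵀ *ᵥ (P *ᵥ y)) + lam • v) := by
    rw [← hGpd.iSup_concave_quadratic]
    congr 1 with w
    have h1 : w ⬝ᵥ (Ξᵀ * P * Ξ) *ᵥ w = (Ξ *ᵥ w) ⬝ᵥ P *ᵥ (Ξ *ᵥ w) := by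
      simp only [← mulVec_mulVec]
      rw [dotProduct_mulVec, vecMul_transpose]
    have h2 : w ⬝ᵥ Ξᵀ *ᵥ (P *ᵥ y) = (Ξ *ᵥ w) ⬝ᵥ P *ᵥ y := by
      rw [dotProduct_mulVec, vecMul_transpose]
    have h3 := dotProduct_mulVec_symm_of_transpose_eq hPt y (Ξ *ᵥ w)
    rw [hG, sub_mulVec, smul_mulVec, smul_mulVec, one_mulVec]
    simp only [mulVec_add, add_dotProduct, dotProduct_add, sub_dotProduct, dotProduct_sub,
      dotProduct_smul, smul_eq_mul, h1, h2, h3, dotProduct_comm v w]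
    ring
  have hzα : lam * trace ((lam • G⁻¹ - 1) * Sig) = (1 - α) * z := by
    rw [hz]
    field_simp [show 1 - α ≠ 0 by linarith]
  have htr : lam ^ 2 * trace (G⁻¹ * Sig) - lam * trace Sig = (1 - α) * z := by
    rw [← hzα]
    simp only [Matrix.sub_mul, Matrix.smul_mul, trace_sub, trace_smul, Matrix.one_mul, smul_eq_mul]
    ring
  have htrSig : trace Sig = (1 / N : ℝ) * ∑ i, what i ⬝ᵥ what i := by
    simp [hSig, trace_sum, trace_vecMulVec]
  have hN' : (N : ℝ) ≠ 0 := by positivity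
  have havg (y : Fin n → ℝ) :
      (1 / N : ℝ) * ∑ i, ⨆ w' : Fin l → ℝ, (α * ((y + Ξ *ᵥ w') ⬝ᵥ P *ᵥ (y + Ξ *ᵥ w') + z)
          - lam * ((what i - w') ⬝ᵥ (what i - w')))
        = α * (y ⬝ᵥ M *ᵥ y) + z := by
    simp only [hsup, Finset.sum_add_distrib, mul_add (1 / N : ℝ)]
    rw [average_quadratic_form hN what hmean hGt, ← hSig, Finset.sum_sub_distrib,
      ← Finset.mul_sum, ← Finset.mul_sum, mul_sub, mul_left_comm _ lam, ← htrSig, hMquad]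
    simp only [mulVec_smul, smul_dotProduct, dotProduct_smul, smul_eq_mul, Finset.sum_const,
      Finset.card_univ, Fintype.card_fin, nsmul_eq_mul]
    rw [mul_left_comm (1 / N : ℝ) α, ← mul_assoc (1 / N : ℝ), one_div_mul_cancel hN']
    linarith
  have hKx : K *ᵥ x = -(H⁻¹ *ᵥ (α • (Bᵀ *ᵥ (M *ᵥ (A *ᵥ x))))) := by
    rw [hK, hPt, Matrix.mul_assoc Bᵀ P, hPM]
    simp only [neg_mulVec, ← mulVec_mulVec, smul_mulVec]
  have hR' : x ⬝ᵥ P *ᵥ x = x ⬝ᵥ Q *ᵥ x + α * ((A *ᵥ x) ⬝ᵥ M *ᵥ (A *ᵥ x))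
      - (α • (Bᵀ *ᵥ (M *ᵥ (A *ᵥ x)))) ⬝ᵥ H⁻¹ *ᵥ (α • (Bᵀ *ᵥ (M *ᵥ (A *ᵥ x)))) := by
    have hPeq : P = Q + α • (Aᵀ * M * A) - α ^ 2 • (Aᵀ * (M * B * H⁻¹ * Bᵀ * M) * A) := by
      have hS' : S = P * Ξ * G⁻¹ * Ξᵀ * P - M * B * H⁻¹ * Bᵀ * M := by
        rw [hS, hMP, Matrix.mul_assoc _ P, hPM]
      conv_lhs => rw [hRiccati, hS']
      rw [hM]
      simp only [Matrix.mul_add, Matrix.add_mul, Matrix.mul_sub, Matrix.sub_mul, Matrix.mul_smul,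
        Matrix.smul_mul, smul_add, smul_sub, smul_smul, ← sq]
      abel
    have h1 : x ⬝ᵥ (Aᵀ * M * A) *ᵥ x = (A *ᵥ x) ⬝ᵥ M *ᵥ (A *ᵥ x) := by
      simp only [← mulVec_mulVec]
      rw [dotProduct_mulVec, vecMul_transpose]
    have h2 : x ⬝ᵥ (Aᵀ * (M * B * H⁻¹ * Bᵀ * M) * A) *ᵥ x
        = (Bᵀ *ᵥ (M *ᵥ (A *ᵥ x))) ⬝ᵥ H⁻¹ *ᵥ (Bᵀ *ᵥ (M *ᵥ (A *ᵥ x))) := by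
      simp only [← mulVec_mulVec]
      rw [dotProduct_mulVec, vecMul_transpose, dotProduct_mulVec, dotProduct_mulVec,
        ← mulVec_transpose, ← mulVec_transpose, hMt]
    conv_lhs => rw [hPeq]
    simp only [sub_mulVec, add_mulVec, smul_mulVec, dotProduct_add, dotProduct_sub, mulVec_smul,
      smul_dotProduct, dotProduct_smul, smul_eq_mul, h1, h2]
    ring
  have hFsq (u : Fin m → ℝ) :
      F u = x ⬝ᵥ P *ᵥ x + z + (u - K *ᵥ x) ⬝ᵥ H *ᵥ (u - K *ᵥ x) := by
    have hsq := hHpd.complete_square u (α • (Bᵀ *ᵥ (M *ᵥ (A *ᵥ x))))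
    have hB : u ⬝ᵥ (Bᵀ * M * B) *ᵥ u = (B *ᵥ u) ⬝ᵥ M *ᵥ (B *ᵥ u) := by
      simp only [← mulVec_mulVec]
      rw [dotProduct_mulVec, vecMul_transpose]
    have hBA : u ⬝ᵥ Bᵀ *ᵥ (M *ᵥ (A *ᵥ x)) = (B *ᵥ u) ⬝ᵥ M *ᵥ (A *ᵥ x) := by
      rw [dotProduct_mulVec, vecMul_transpose]
    have hsymm := dotProduct_mulVec_symm_of_transpose_eq hMt (A *ᵥ x) (B *ᵥ u)
    have hHu : u ⬝ᵥ H *ᵥ u = u ⬝ᵥ R *ᵥ u + α * ((B *ᵥ u) ⬝ᵥ M *ᵥ (B *ᵥ u)) := by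
      rw [hH, add_mulVec, smul_mulVec, dotProduct_add, dotProduct_smul, hB, smul_eq_mul]
    rw [hHu, dotProduct_smul, hBA, smul_eq_mul] at hsq
    rw [hKx, sub_neg_eq_add, hR', hF]
    simp only [havg]
    rw [mulVec_add, add_dotProduct, dotProduct_add, dotProduct_add, hsymm]
    linarith
  have hFK : F (K *ᵥ x) = x ⬝ᵥ P *ᵥ x + z := by simp [hFsq]
  refine ⟨fun u => ?_, fun u hu => ?_, hFK⟩
  · have h := hHpd.posSemidef.dotProduct_mulVec_nonneg (u - K *ᵥ x)
    simp only [star_trivial] at h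
    rw [hFK, hFsq]
    linarith
  · by_contra hne
    have h := hHpd.dotProduct_mulVec_pos (sub_ne_zero.2 hne)
    simp only [star_trivial] at h
    rw [hFK, hFsq] at hu
    linarith
end

section
/- Consider the linear-quadratic Wasserstein-penalty setting, and let P, z, K be as in the Riccati solution (P symmetric positive semidefinite with λI − αΞᵀPΞ positive definite, P = Q + αAᵀPA + α²AᵀSA, z = (λ/(1−α)) tr[(λ(λI − αΞᵀPΞ)⁻¹ − I)Σ], K the associated feedback gain), and set v'(y) := yᵀPy + z. For each x ∈ ℝⁿ and each i, define w'^(i)_x := (λI − αΞᵀPΞ)⁻¹ [ αΞᵀP(A + BK)x + λ ŵ^(i) ], and let γ'(x) := (1/N) Σ_{i=1}^N δ_{w'^(i)_x}. Then γ'(x) maximizes, over all Borel probability measures μ on ℝˡ, the functional μ ↦ c(x, Kx) − λ W₂(μ, ν_N)² + α ∫_{ℝˡ} v'(Ax + BKx + Ξw) μ(dw), where ν_N := (1/N) Σ_{i=1}^N δ_{ŵ^(i)} and W₂ is the order-2 Wasserstein distance with Euclidean cost; i.e., γ'(x) is a worst-case distribution at x for the Wasserstein-penalty problem. -/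
open Matrix MeasureTheory ENNReal

/-- The squared order-2 Wasserstein distance on `ℝ^l` with Euclidean transport cost
`‖w − w'‖²`, defined as the infimum over couplings of the expected squared distance. -/
noncomputable def W2sq {l : ℕ} (μ ν : Measure (Fin l → ℝ)) : ℝ≥0∞ :=
  ⨅ κ ∈ {κ : Measure ((Fin l → ℝ) × (Fin l → ℝ)) | IsProbabilityMeasure κ ∧
      κ.map Prod.fst = μ ∧ κ.map Prod.snd = ν},
    ∫⁻ q, ENNReal.ofReal ((q.1 - q.2) ⬝ᵥ (q.1 - q.2)) ∂κ

/-- If `G g = b + λ w'` with `G = λ I - α Ξᵀ P Ξ` positive semidefinite and `b = α Ξᵀ P y`, then `g`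
maximizes `w ↦ α (y + Ξ w)ᵀ P (y + Ξ w) - λ ‖w - w'‖²`. -/
theorem penalized_quadratic_le {n l : ℕ} {Ξ : Matrix (Fin n) (Fin l) ℝ}
    {P : Matrix (Fin n) (Fin n) ℝ} (hP : P.PosSemidef) {α lam : ℝ}
    {G : Matrix (Fin l) (Fin l) ℝ}
    (hG : G = lam • (1 : Matrix (Fin l) (Fin l) ℝ) - α • (Ξᵀ * P * Ξ)) (hGp : G.PosSemidef)
    (y : Fin n → ℝ) {g w' : Fin l → ℝ}
    (hg : G *ᵥ g = α • ((Ξᵀ * P) *ᵥ y) + lam • w') (w : Fin l → ℝ) :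
    α * ((y + Ξ *ᵥ w) ⬝ᵥ P *ᵥ (y + Ξ *ᵥ w)) - lam * ((w - w') ⬝ᵥ (w - w')) ≤
      α * ((y + Ξ *ᵥ g) ⬝ᵥ P *ᵥ (y + Ξ *ᵥ g)) - lam * ((g - w') ⬝ᵥ (g - w')) := by
  obtain ⟨d, rfl⟩ : ∃ d, w = g + d := ⟨w - g, by simp⟩
  have hsymm : ∀ u v : Fin n → ℝ, u ⬝ᵥ P *ᵥ v = v ⬝ᵥ P *ᵥ u := fun u v ↦ by
    have hPt : Pᵀ = P := by simpa [Matrix.IsHermitian] using hP.isHermitian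
    rw [dotProduct_mulVec, ← mulVec_transpose, hPt, dotProduct_comm]
  have hpull : ∀ v : Fin n → ℝ, d ⬝ᵥ (Ξᵀ * P) *ᵥ v = (Ξ *ᵥ d) ⬝ᵥ P *ᵥ v := fun v ↦ by
    rw [← mulVec_mulVec, dotProduct_mulVec, vecMul_transpose]
  have hGv : ∀ v, d ⬝ᵥ G *ᵥ v = lam * (d ⬝ᵥ v) - α * ((Ξ *ᵥ d) ⬝ᵥ P *ᵥ (Ξ *ᵥ v)) := fun v ↦ by
    rw [hG, sub_mulVec, smul_mulVec, smul_mulVec, one_mulVec, dotProduct_sub, dotProduct_smul,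
      dotProduct_smul, ← mulVec_mulVec, hpull, smul_eq_mul, smul_eq_mul]
  have hdd : 0 ≤ d ⬝ᵥ G *ᵥ d := by simpa using hGp.dotProduct_mulVec_nonneg d
  have hdg := congrArg (d ⬝ᵥ ·) hg
  simp only [dotProduct_add, dotProduct_smul, smul_eq_mul, hpull, hGv] at hdg hdd
  have h₁ := hsymm (Ξ *ᵥ d) y
  have h₂ := hsymm (Ξ *ᵥ d) (Ξ *ᵥ g)
  simp only [mulVec_add, dotProduct_add, add_dotProduct, dotProduct_sub, sub_dotProduct,
    dotProduct_comm g d, dotProduct_comm w' d, dotProduct_comm w' g] at hdg hdd ⊢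
  rw [← h₁, ← h₂]
  linarith

/-- The uniform measure on a finite family of points is a probability measure. -/
theorem isProbabilityMeasure_uniform_dirac {E : Type*} [MeasurableSpace E] {N : ℕ} (hN : 0 < N)
    (p : Fin N → E) :
    IsProbabilityMeasure ((N : ℝ≥0∞)⁻¹ • ∑ i, Measure.dirac (p i)) := by
  constructor
  simp only [Measure.smul_apply, Measure.finsetSum_apply, measure_univ, Finset.sum_const,
    Finset.card_univ, Fintype.card_fin, nsmul_eq_mul, mul_one, smul_eq_mul]
  exact ENNReal.inv_mul_cancel (by exact_mod_cast hN.ne') (ENNReal.natCast_ne_top N)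

theorem integrable_uniform_dirac {E : Type*} [MeasurableSpace E] {N : ℕ} (hN : 0 < N)
    (p : Fin N → E) {f : E → ℝ} (hf : Measurable f) :
    Integrable f ((N : ℝ≥0∞)⁻¹ • ∑ i, Measure.dirac (p i)) := by
  refine Integrable.smul_measure ?_ (by simpa using hN.ne')
  exact integrable_finsetSum_measure.2 fun i _ ↦
    integrable_dirac' hf.stronglyMeasurable (by simp)

theorem integral_uniform_dirac {E : Type*} [MeasurableSpace E] {N : ℕ}
    (p : Fin N → E) {f : E → ℝ} (hf : Measurable f) :
    ∫ w, f w ∂((N : ℝ≥0∞)⁻¹ • ∑ i, Measure.dirac (p i)) = (N : ℝ)⁻¹ * ∑ i, f (p i) := by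
  rw [integral_smul_measure, integral_finsetSum_measure fun i _ ↦
    integrable_dirac' hf.stronglyMeasurable (by simp)]
  simp [integral_dirac' _ _ hf.stronglyMeasurable]

/-- Pairing two finite families index by index bounds the Wasserstein distance of their uniform
measures. -/
theorem W2sq_uniform_dirac_le {l N : ℕ} (hN : 0 < N) (p q : Fin N → (Fin l → ℝ)) :
    W2sq ((N : ℝ≥0∞)⁻¹ • ∑ i, Measure.dirac (p i)) ((N : ℝ≥0∞)⁻¹ • ∑ i, Measure.dirac (q i)) ≤
      ENNReal.ofReal ((N : ℝ)⁻¹ * ∑ i, (p i - q i) ⬝ᵥ (p i - q i)) := by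
  have hmeas : Measurable fun r : (Fin l → ℝ) × (Fin l → ℝ) ↦ (r.1 - r.2) ⬝ᵥ (r.1 - r.2) := by
    unfold dotProduct; fun_prop
  have hmap : ∀ f : (Fin l → ℝ) × (Fin l → ℝ) → (Fin l → ℝ), Measurable f →
      ((N : ℝ≥0∞)⁻¹ • ∑ i, Measure.dirac (p i, q i)).map f =
        (N : ℝ≥0∞)⁻¹ • ∑ i, Measure.dirac (f (p i, q i)) := fun f hf ↦ by
    rw [Measure.map_smul, Measure.map_finset_sum hf.aemeasurable]
    simp [Measure.map_dirac' hf]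
  refine (iInf₂_le ((N : ℝ≥0∞)⁻¹ • ∑ i, Measure.dirac (p i, q i))
    ⟨isProbabilityMeasure_uniform_dirac hN _, hmap _ measurable_fst, hmap _ measurable_snd⟩).trans
    (le_of_eq ?_)
  rw [← ofReal_integral_eq_lintegral_ofReal (integrable_uniform_dirac hN _ hmeas)
    (.of_forall fun r ↦ by simpa using dotProduct_star_self_nonneg (r.1 - r.2)),
    integral_uniform_dirac _ hmeas]

/-- Weak duality: if `α f(w) - λ ‖w - w'‖² ≤ φ(w')` pointwise, then
`α ∫ f dμ - λ C ≤ ∫ φ dν` for the cost `C` of every finite-cost coupling of `μ` and `ν`. -/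
theorem integral_sub_transport_le {l : ℕ} {f φ : (Fin l → ℝ) → ℝ} (hf : Measurable f)
    {α lam z : ℝ} (hα : 0 < α) (hz : ∀ w, z ≤ f w)
    (hle : ∀ w w', α * f w - lam * ((w - w') ⬝ᵥ (w - w')) ≤ φ w')
    {ν : Measure (Fin l → ℝ)} (hφ : Integrable φ ν)
    {κ : Measure ((Fin l → ℝ) × (Fin l → ℝ))} [IsProbabilityMeasure κ]
    (hν : κ.map Prod.snd = ν)
    (hfin : ∫⁻ q, ENNReal.ofReal ((q.1 - q.2) ⬝ᵥ (q.1 - q.2)) ∂κ ≠ ∞) :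
    α * ∫ w, f w ∂(κ.map Prod.fst) -
      lam * (∫⁻ q, ENNReal.ofReal ((q.1 - q.2) ⬝ᵥ (q.1 - q.2)) ∂κ).toReal ≤ ∫ w, φ w ∂ν := by
  subst hν
  have hmeas : Measurable fun r : (Fin l → ℝ) × (Fin l → ℝ) ↦ (r.1 - r.2) ⬝ᵥ (r.1 - r.2) := by
    unfold dotProduct; fun_prop
  have hnn : ∀ r : (Fin l → ℝ) × (Fin l → ℝ), 0 ≤ (r.1 - r.2) ⬝ᵥ (r.1 - r.2) := fun r ↦ by
    simpa using dotProduct_star_self_nonneg (r.1 - r.2)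
  have hc : Integrable (fun r : (Fin l → ℝ) × (Fin l → ℝ) ↦ (r.1 - r.2) ⬝ᵥ (r.1 - r.2)) κ :=
    (lintegral_ofReal_ne_top_iff_integrable hmeas.aestronglyMeasurable (.of_forall hnn)).1 hfin
  have hφ' : Integrable (fun r : (Fin l → ℝ) × (Fin l → ℝ) ↦ φ r.2) κ :=
    hφ.comp_measurable measurable_snd
  have hdiff : Integrable (fun r : (Fin l → ℝ) × (Fin l → ℝ) ↦ α * (f r.1 - z)) κ := by
    refine ((hc.const_mul lam).add (hφ'.sub (integrable_const (α * z)))).mono'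
      (((hf.comp measurable_fst).sub_const z).const_mul α).aestronglyMeasurable
      (.of_forall fun r ↦ ?_)
    rw [Real.norm_of_nonneg (mul_nonneg hα.le (sub_nonneg.2 (hz _)))]
    have := hle r.1 r.2
    simp only [Pi.add_apply, Pi.sub_apply]
    linarith
  have hfi : Integrable (fun r : (Fin l → ℝ) × (Fin l → ℝ) ↦ α * f r.1) κ := by
    refine (hdiff.add (integrable_const (α * z))).congr (.of_forall fun r ↦ ?_)
    simp only [Pi.add_apply]
    ring
  rw [← ofReal_integral_eq_lintegral_ofReal hc (.of_forall hnn),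
    ENNReal.toReal_ofReal (integral_nonneg hnn),
    integral_map measurable_fst.aemeasurable hf.aestronglyMeasurable,
    integral_map measurable_snd.aemeasurable hφ.aestronglyMeasurable,
    ← integral_const_mul, ← integral_const_mul, ← integral_sub hfi (hc.const_mul lam)]
  exact integral_mono (hfi.sub (hc.const_mul lam)) hφ' fun r ↦ hle r.1 r.2

/-- Theorem 5, worst-case distribution part: in the linear-quadratic
Wasserstein-penalty setting with Riccati solution `(P, z, K)` and value function
`v'(y) = yᵀPy + z`, the discrete measure `γ'(x) = (1/N) ∑ᵢ δ_{w'⁽ⁱ⁾ₓ}` with atoms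
`w'⁽ⁱ⁾ₓ = (λI − αΞᵀPΞ)⁻¹[αΞᵀP(A + BK)x + λŵ⁽ⁱ⁾]` maximizes
`μ ↦ c(x,Kx) − λW₂(μ,ν_N)² + α∫ v'(Ax + BKx + Ξw) μ(dw)` over all Borel probability
measures `μ` on `ℝ^l`, i.e. it is a worst-case distribution at `x`. -/
theorem lq_worst_case_distribution
    {n m l : ℕ}
    (A : Matrix (Fin n) (Fin n) ℝ) (B : Matrix (Fin n) (Fin m) ℝ)
    (Ξ : Matrix (Fin n) (Fin l) ℝ)
    (Q : Matrix (Fin n) (Fin n) ℝ) (hQ : Q.PosSemidef)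
    (R : Matrix (Fin m) (Fin m) ℝ) (hR : R.PosDef)
    (α : ℝ) (hα0 : 0 < α) (hα1 : α < 1)
    (lam : ℝ) (hlam : 0 < lam)
    (N : ℕ) (hN : 0 < N) (what : Fin N → (Fin l → ℝ))
    (hmean : (1 / N : ℝ) • ∑ i, what i = 0)
    (Sig : Matrix (Fin l) (Fin l) ℝ)
    (hSig : Sig = (1 / N : ℝ) • ∑ i, vecMulVec (what i) (what i))
    (P : Matrix (Fin n) (Fin n) ℝ) (hP : P.PosSemidef)
    (G : Matrix (Fin l) (Fin l) ℝ)
    (hG : G = lam • (1 : Matrix (Fin l) (Fin l) ℝ) - α • (Ξᵀ * P * Ξ))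
    (hGpd : G.PosDef)
    (S : Matrix (Fin n) (Fin n) ℝ)
    (hS : S = P * Ξ * G⁻¹ * Ξᵀ * P
      - ((1 : Matrix (Fin n) (Fin n) ℝ) + α • (Ξ * G⁻¹ * Ξᵀ * P))ᵀ * P * B
          * (R + α • (Bᵀ * (P + α • (P * Ξ * G⁻¹ * Ξᵀ * P)) * B))⁻¹
          * Bᵀ * P * ((1 : Matrix (Fin n) (Fin n) ℝ) + α • (Ξ * G⁻¹ * Ξᵀ * P)))
    (hRiccati : P = Q + α • (Aᵀ * P * A) + (α ^ 2) • (Aᵀ * S * A))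
    (z : ℝ)
    (hz : z = lam / (1 - α) * Matrix.trace ((lam • G⁻¹ - 1) * Sig))
    (K : Matrix (Fin m) (Fin n) ℝ)
    (hK : K = -((R + α • (Bᵀ * (P + α • (P * Ξ * G⁻¹ * Ξᵀ * P)) * B))⁻¹
        * (α • (Bᵀ * Pᵀ * ((1 : Matrix (Fin n) (Fin n) ℝ) + α • (Ξ * G⁻¹ * Ξᵀ * P)) * A))))
    (νN : Measure (Fin l → ℝ)) (hνN : νN = ((N : ℝ≥0∞))⁻¹ • ∑ i, Measure.dirac (what i)) :
    ∀ (x : Fin n → ℝ) (wx : Fin N → (Fin l → ℝ)),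
      (wx = fun i => G⁻¹.mulVec (α • (Ξᵀ * P).mulVec ((A + B * K).mulVec x) + lam • what i)) →
      ∀ Jf : Measure (Fin l → ℝ) → EReal,
        (Jf = fun μ =>
          ((x ⬝ᵥ Q.mulVec x + (K.mulVec x) ⬝ᵥ R.mulVec (K.mulVec x) : ℝ) : EReal)
            - ((lam : ℝ) : EReal) * ((W2sq μ νN : ℝ≥0∞) : EReal)
            + ((α * ∫ w, ((A.mulVec x + B.mulVec (K.mulVec x) + Ξ.mulVec w) ⬝ᵥ
                P.mulVec (A.mulVec x + B.mulVec (K.mulVec x) + Ξ.mulVec w) + z) ∂μ : ℝ)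
              : EReal)) →
        ∀ μ : Measure (Fin l → ℝ), IsProbabilityMeasure μ →
          Jf μ ≤ Jf (((N : ℝ≥0∞))⁻¹ • ∑ i, Measure.dirac (wx i)) := by
  intro x wx hwx Jf hJf μ hμ
  set y : Fin n → ℝ := A *ᵥ x + B *ᵥ (K *ᵥ x) with hy
  have hyAB : (A + B * K) *ᵥ x = y := by rw [add_mulVec, ← mulVec_mulVec]
  set f : (Fin l → ℝ) → ℝ := fun w ↦ (y + Ξ *ᵥ w) ⬝ᵥ P *ᵥ (y + Ξ *ᵥ w) + z with hf
  set g : (Fin l → ℝ) → (Fin l → ℝ) :=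
    fun w' ↦ G⁻¹ *ᵥ (α • ((Ξᵀ * P) *ᵥ y) + lam • w') with hg
  set φ : (Fin l → ℝ) → ℝ :=
    fun w' ↦ α * f (g w') - lam * ((g w' - w') ⬝ᵥ (g w' - w')) with hφ
  have hwg : ∀ i, wx i = g (what i) := fun i ↦ by rw [hwx, hyAB]
  have hfm : Measurable f := by
    refine Continuous.measurable ?_
    fun_prop
  have hφm : Measurable φ := by
    refine Continuous.measurable ?_
    fun_prop
  have hfz : ∀ w, z ≤ f w := fun w ↦ by
    have : 0 ≤ (y + Ξ *ᵥ w) ⬝ᵥ P *ᵥ (y + Ξ *ᵥ w) := by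
      simpa using hP.dotProduct_mulVec_nonneg (y + Ξ *ᵥ w)
    simpa [hf] using this
  have hle : ∀ w w', α * f w - lam * ((w - w') ⬝ᵥ (w - w')) ≤ φ w' := fun w w' ↦ by
    have hGg : G *ᵥ g w' = α • ((Ξᵀ * P) *ᵥ y) + lam • w' := by
      rw [hg, mulVec_mulVec, mul_nonsing_inv _ (isUnit_iff_isUnit_det _ |>.1 hGpd.isUnit),
        one_mulVec]
    have := penalized_quadratic_le hP hG hGpd.posSemidef y hGg w
    simp only [hφ, hf, mul_add]
    linarith
  have hφint : Integrable φ νN := hνN ▸ integrable_uniform_dirac hN what hφm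
  have hvalue : ∫ w, φ w ∂νN = α * ∫ w, f w ∂((N : ℝ≥0∞)⁻¹ • ∑ i, Measure.dirac (wx i)) -
      lam * ((N : ℝ)⁻¹ * ∑ i, (wx i - what i) ⬝ᵥ (wx i - what i)) := by
    rw [hνN, integral_uniform_dirac _ hφm, integral_uniform_dirac _ hfm]
    simp only [hφ, hwg, Finset.sum_sub_distrib, ← Finset.mul_sum]
    ring
  have hnn : 0 ≤ (N : ℝ)⁻¹ * ∑ i, (wx i - what i) ⬝ᵥ (wx i - what i) :=
    mul_nonneg (by positivity) (Finset.sum_nonneg fun i _ ↦ by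
      simpa using dotProduct_star_self_nonneg (wx i - what i))
  have hγ := W2sq_uniform_dirac_le hN wx what
  rw [← hνN] at hγ
  subst hJf
  dsimp only
  set c : ℝ := x ⬝ᵥ Q *ᵥ x + (K *ᵥ x) ⬝ᵥ R *ᵥ (K *ᵥ x)
  change _ - _ + ((α * ∫ w, f w ∂μ : ℝ) : EReal) ≤ _ - _ +
    ((α * ∫ w, f w ∂((N : ℝ≥0∞)⁻¹ • ∑ i, Measure.dirac (wx i)) : ℝ) : EReal)
  set If := ∫ w, f w ∂((N : ℝ≥0∞)⁻¹ • ∑ i, Measure.dirac (wx i))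
  set C := (N : ℝ)⁻¹ * ∑ i, (wx i - what i) ⬝ᵥ (wx i - what i)
  rcases eq_or_ne (W2sq μ νN) ∞ with htop | htop
  · rw [htop, EReal.coe_ennreal_top, EReal.coe_mul_top_of_pos hlam, sub_eq_add_neg, EReal.neg_top, EReal.add_bot,
      EReal.bot_add]
    exact bot_le
  · have hμle : α * ∫ w, f w ∂μ - lam * (W2sq μ νN).toReal ≤ α * If - lam * C := by
      suffices ENNReal.ofReal ((α * ∫ w, f w ∂μ - (α * If - lam * C)) / lam) ≤ W2sq μ νN by
        have := (ENNReal.ofReal_le_iff_le_toReal htop).1 this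
        rw [div_le_iff₀ hlam] at this
        linarith
      refine le_iInf₂ fun κ ⟨hκ, hκμ, hκν⟩ ↦ ?_
      by_cases hfin : ∫⁻ q, ENNReal.ofReal ((q.1 - q.2) ⬝ᵥ (q.1 - q.2)) ∂κ = ∞
      · exact hfin ▸ le_top
      · have := integral_sub_transport_le hfm hα0 hfz hle hφint hκν hfin
        rw [hκμ, hvalue] at this
        rw [ENNReal.ofReal_le_iff_le_toReal hfin, div_le_iff₀ hlam]
        linarith
    have hγtop : W2sq ((N : ℝ≥0∞)⁻¹ • ∑ i, Measure.dirac (wx i)) νN ≠ ∞ :=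
      ne_top_of_le_ne_top ENNReal.ofReal_ne_top hγ
    have hγle := mul_le_mul_of_nonneg_left (ENNReal.toReal_le_of_le_ofReal hnn hγ) hlam.le
    rw [← EReal.coe_ennreal_toReal htop, ← EReal.coe_ennreal_toReal hγtop]
    norm_cast
    linarith
end
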